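/- Under Assumptions (A) and (B), as n → ∞: (a) ∑_{i=0}^{p−1} (tr(Q_i) − 1) → 0 in probability; (b) max_{i=0,…,p−1} |tr(Q_i) − 1| → 0 in probability; and (c) for every ε > 0, P(max_{i=0,…,p−1} |tr(Q_i) − 1| > ε) ≤ ε^{−2} ∑_{i=1}^{p−1} Var(tr(Q_i)) = O(1/n). -/

import Mathlib

open MeasureTheory ProbabilityTheory Matrix Filter Topology

noncomputable section

/-- The standard Gaussian measure on `ℝ^d` (modeled on `Fin d → ℝ`). -/
def gaussianPi (d : ℕ) : Measure (Fin d → ℝ) :=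
  Measure.pi fun _ => gaussianReal 0 1

/-- The Euclidean norm on `Fin n → ℝ`. -/
def euclidNorm {n : ℕ} (x : Fin n → ℝ) : ℝ :=
  Real.sqrt (∑ j, x j ^ 2)

/-- The uniform distribution on the unit sphere `S^{n-1} ⊆ ℝ^n`, realized as the law of a
normalized standard Gaussian vector. -/
def uniformSphere (n : ℕ) : Measure (Fin n → ℝ) :=
  (gaussianPi n).map fun x => (euclidNorm x)⁻¹ • x

/-- The joint law of `p` independent uniform random directions `u_1, …, u_p` on `S^{n-1}`. -/
def sphereLaw (n p : ℕ) : Measure (Fin p → Fin n → ℝ) :=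
  Measure.pi fun _ => uniformSphere n

/-- The `(i+1)`-st sample vector `u_{i+1}` (junk value `0` if `i ≥ p`). -/
def uVec {n p : ℕ} (ω : Fin p → Fin n → ℝ) (i : ℕ) : Fin n → ℝ :=
  if h : i < p then ω ⟨i, h⟩ else 0

/-- The matrix `B_{(i)} = (b_1, …, b_i)ᵀ` with rows `b_j = A u_j`. -/
def rowMat {n p : ℕ} (A : Matrix (Fin n) (Fin n) ℝ) (ω : Fin p → Fin n → ℝ) (i : ℕ) :
    Matrix (Fin i) (Fin n) ℝ :=
  Matrix.of fun k j => A.mulVec (uVec ω (k : ℕ)) j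

/-- The projection matrix `P_i = I_n − B_{(i)}ᵀ (B_{(i)} B_{(i)}ᵀ)⁻¹ B_{(i)}` (with `P_0 = I_n`). -/
def projMat {n p : ℕ} (A : Matrix (Fin n) (Fin n) ℝ) (ω : Fin p → Fin n → ℝ) (i : ℕ) :
    Matrix (Fin n) (Fin n) ℝ :=
  1 - (rowMat A ω i)ᵀ * (rowMat A ω i * (rowMat A ω i)ᵀ)⁻¹ * rowMat A ω i

/-- The entrywise expectation `E[P_i]` of the projection matrix `P_i`. -/
def meanProj (n p : ℕ) (A : Matrix (Fin n) (Fin n) ℝ) (i : ℕ) :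
    Matrix (Fin n) (Fin n) ℝ :=
  Matrix.of fun k l => ∫ ω, projMat A ω i k l ∂(sphereLaw n p)

/-- `T_i = tr(A² E[P_i])`. -/
def Tstat (n p : ℕ) (A : Matrix (Fin n) (Fin n) ℝ) (i : ℕ) : ℝ :=
  Matrix.trace (A * A * meanProj n p A i)

/-- `Q_i = A P_i A / T_i`. -/
def Qmat {n p : ℕ} (A : Matrix (Fin n) (Fin n) ℝ) (ω : Fin p → Fin n → ℝ) (i : ℕ) :
    Matrix (Fin n) (Fin n) ℝ :=
  (Tstat n p A i)⁻¹ • (A * projMat A ω i * A)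

/-- `Z̃_{i+1} = n u_{i+1}ᵀ Q_i u_{i+1} − 1`. -/
def Ztil {n p : ℕ} (A : Matrix (Fin n) (Fin n) ℝ) (ω : Fin p → Fin n → ℝ) (i : ℕ) : ℝ :=
  (n : ℝ) * (uVec ω i ⬝ᵥ (Qmat A ω i).mulVec (uVec ω i)) - 1

/-- The variance `Var(f) = E[(f − E f)²]` of a real random variable `f` under `μ`. -/
def varInt {α : Type*} [MeasurableSpace α] (μ : Measure α) (f : α → ℝ) : ℝ :=
  ∫ ω, (f ω - ∫ ω', f ω' ∂μ) ^ 2 ∂μ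

end

theorem bdd_integrable {Ω : Type*} [MeasurableSpace Ω] {μ : Measure Ω} [IsFiniteMeasure μ]
    {f : Ω → ℝ} (hf : Measurable f) {c : ℝ} (hb : ∀ x, |f x| ≤ c) : Integrable f μ :=
  Integrable.of_bound hf.aestronglyMeasurable c (Eventually.of_forall fun x => by
    simpa [Real.norm_eq_abs] using hb x)

theorem sq_bdd {a c : ℝ} (h : |a| ≤ c) : |a ^ 2| ≤ c ^ 2 := by
  rw [abs_pow]; gcongr

theorem sub_bdd {a b c d : ℝ} (h : |a| ≤ c) (h' : |b| ≤ d) : |a - b| ≤ c + d :=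
  (abs_sub a b).trans (add_le_add h h')

theorem int_bdd {Ω : Type*} [MeasurableSpace Ω] {μ : Measure Ω} [IsProbabilityMeasure μ]
    {f : Ω → ℝ} {c : ℝ} (hb : ∀ x, |f x| ≤ c) : |∫ x, f x ∂μ| ≤ c := by
  have := norm_integral_le_of_norm_le_const (μ := μ) (f := f) (C := c)
    (Eventually.of_forall fun x => by simpa [Real.norm_eq_abs] using hb x)
  simpa using this

/-- Bias-variance decomposition. -/
theorem bias_var {Ω : Type*} [MeasurableSpace Ω] {μ : Measure Ω} [IsProbabilityMeasure μ]
    {f : Ω → ℝ} (hf : Measurable f) {c : ℝ} (hb : ∀ x, |f x| ≤ c) (a : ℝ) :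
    ∫ x, (f x - a) ^ 2 ∂μ = ∫ x, (f x - ∫ y, f y ∂μ) ^ 2 ∂μ + (∫ y, f y ∂μ - a) ^ 2 := by
  set m := ∫ y, f y ∂μ with hm
  have hi : Integrable f μ := bdd_integrable hf hb
  have h1 : ∀ x, (f x - a) ^ 2 = (f x - m) ^ 2 + (2 * (m - a) * (f x - m) + (m - a) ^ 2) := by
    intro x; ring
  have i1 : Integrable (fun x => (f x - m) ^ 2) μ :=
    bdd_integrable ((hf.sub_const m).pow_const 2)
      (fun x => sq_bdd (sub_bdd (hb x) le_rfl))
  have i2 : Integrable (fun x => 2 * (m - a) * (f x - m)) μ :=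
    (hi.sub (integrable_const m)).const_mul _
  simp_rw [h1]
  have i3 : Integrable (fun x => 2 * (m - a) * (f x - m) + (m - a) ^ 2) μ :=
    i2.add (integrable_const _)
  rw [integral_add i1 i3, integral_add i2 (integrable_const _),
    integral_const_mul, integral_sub hi (integrable_const _)]
  simp [← hm]

theorem jensen_sq {Ω : Type*} [MeasurableSpace Ω] {μ : Measure Ω} [IsProbabilityMeasure μ]
    {f : Ω → ℝ} (hf : Measurable f) {c : ℝ} (hb : ∀ x, |f x| ≤ c) :
    (∫ x, f x ∂μ) ^ 2 ≤ ∫ x, f x ^ 2 ∂μ := by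
  have := bias_var (μ := μ) hf hb 0
  simp only [sub_zero] at this
  rw [this]
  have : 0 ≤ ∫ x, (f x - ∫ y, f y ∂μ) ^ 2 ∂μ := integral_nonneg fun x => sq_nonneg _
  linarith

theorem meas_cons {α : Type*} [MeasurableSpace α] {n : ℕ} :
    Measurable (fun z : α × (Fin n → α) => (Fin.cons z.1 z.2 : Fin (n + 1) → α)) := by
  rw [measurable_pi_iff]
  intro i
  refine Fin.cases ?_ (fun j => ?_) i
  · simpa using measurable_fst
  · simp only [Fin.cons_succ]; fun_prop

theorem mp_cons {α : Type*} [MeasurableSpace α] (μ : Measure α) [IsProbabilityMeasure μ] (n : ℕ) :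
    MeasurePreserving (fun z : α × (Fin n → α) => (Fin.cons z.1 z.2 : Fin (n + 1) → α))
      (μ.prod (Measure.pi fun _ => μ)) (Measure.pi fun _ => μ) := by
  have := (measurePreserving_piFinSuccAbove (fun _ : Fin (n + 1) => μ) 0).symm
  refine ⟨meas_cons, ?_⟩
  rw [← this.map_eq]
  congr 1
  funext z
  exact (Fin.insertNth_zero' z.1 z.2).symm

theorem integral_cons {α : Type*} [MeasurableSpace α] (μ : Measure α) [IsProbabilityMeasure μ]
    (n : ℕ) {f : (Fin (n + 1) → α) → ℝ} (hf : Measurable f) {c : ℝ} (hb : ∀ x, |f x| ≤ c) :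
    ∫ x, f x ∂(Measure.pi fun _ : Fin (n + 1) => μ)
      = ∫ y, ∫ x, f (Fin.cons x y) ∂μ ∂(Measure.pi fun _ : Fin n => μ) := by
  have hmp := mp_cons μ n
  rw [← hmp.map_eq, integral_map hmp.measurable.aemeasurable hf.aestronglyMeasurable,
    integral_prod_symm]
  exact bdd_integrable (hf.comp hmp.measurable) (fun x => hb _)

/-- The Efron-Stein inequality for bounded functions. -/
theorem efron_stein {α : Type*} [MeasurableSpace α] (μ : Measure α) [IsProbabilityMeasure μ]
    (c : ℝ) : ∀ (n : ℕ) (f : (Fin n → α) → ℝ) (F : Fin n → (Fin n → α) → ℝ),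
    Measurable f → (∀ x, |f x| ≤ c) → (∀ j, Measurable (F j)) → (∀ j x, |F j x| ≤ c) →
    (∀ j x y, F j (Function.update x j y) = F j x) →
    ∫ x, (f x - ∫ y, f y ∂(Measure.pi fun _ => μ)) ^ 2 ∂(Measure.pi fun _ => μ)
      ≤ ∑ j, ∫ x, (f x - F j x) ^ 2 ∂(Measure.pi fun _ => μ) := by
  intro n
  induction n with
  | zero =>
    intro f F hf hb hF hFb hFu
    have : ∀ x : Fin 0 → α, f x = f default := fun x => by rw [Subsingleton.elim x default]
    simp [this]
  | succ n ih =>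
    intro f F hf hb hF hFb hFu
    set G : (Fin n → α) → ℝ := fun y => ∫ x, f (Fin.cons x y) ∂μ with hG
    have fibm : ∀ {h : (Fin (n + 1) → α) → ℝ}, Measurable h →
        ∀ y : Fin n → α, Measurable fun x => h (Fin.cons x y) := fun hh y =>
      hh.comp (meas_cons.comp (measurable_id.prodMk measurable_const))
    have margm : ∀ {h : (Fin (n + 1) → α) → ℝ}, Measurable h →
        Measurable fun y : Fin n → α => ∫ x, h (Fin.cons x y) ∂μ := fun hh =>
      ((hh.comp meas_cons).stronglyMeasurable.integral_prod_left').measurable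
    have hGm : Measurable G := margm hf
    have hGb : ∀ y, |G y| ≤ c := fun y => int_bdd fun x => hb _
    set m := ∫ y, f y ∂(Measure.pi fun _ => μ) with hm
    have hmG : m = ∫ y, G y ∂(Measure.pi fun _ => μ) := integral_cons μ n hf hb
    rw [integral_cons μ n ((hf.sub_const m).pow_const 2)
      (fun x => sq_bdd (sub_bdd (hb x) le_rfl))]
    have e1 : ∀ y : Fin n → α, ∫ x, (f (Fin.cons x y) - m) ^ 2 ∂μ
        ≤ ∫ x, (f (Fin.cons x y) - F 0 (Fin.cons x y)) ^ 2 ∂μ + (G y - m) ^ 2 := by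
      intro y
      rw [bias_var (fibm hf y) (fun x => hb _) m]
      refine add_le_add ?_ le_rfl
      by_cases hα : Nonempty α
      · obtain ⟨x0⟩ := hα
        have : ∀ x, F 0 (Fin.cons x y) = F 0 (Fin.cons x0 y) := by
          intro x
          rw [← hFu 0 (Fin.cons x0 y) x, Fin.update_cons_zero]
        simp_rw [this]
        rw [bias_var (fibm hf y) (fun x => hb _) (F 0 (Fin.cons x0 y))]
        have := sq_nonneg (∫ x, f (Fin.cons x y) ∂μ - F 0 (Fin.cons x0 y))
        linarith
      · have : IsEmpty α := not_nonempty_iff.mp hα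
        simp [Measure.eq_zero_of_isEmpty μ]
    have bF : ∀ j x, |(f x - F j x) ^ 2| ≤ (c + c) ^ 2 := fun j x =>
      sq_bdd (sub_bdd (hb x) (hFb j x))
    have mF : ∀ j, Measurable fun x => (f x - F j x) ^ 2 := fun j => (hf.sub (hF j)).pow_const 2
    have iF : ∀ j, Integrable (fun y : Fin n → α =>
        ∫ x, (f (Fin.cons x y) - F j (Fin.cons x y)) ^ 2 ∂μ) (Measure.pi fun _ => μ) := fun j =>
      bdd_integrable (margm (mF j)) (fun y => int_bdd fun x => bF j _)
    have iG : Integrable (fun y => (G y - m) ^ 2) (Measure.pi fun _ => μ) :=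
      bdd_integrable ((hGm.sub_const m).pow_const 2)
        (fun x => sq_bdd (sub_bdd (hGb x) le_rfl))
    calc _ ≤ ∫ y, (∫ x, (f (Fin.cons x y) - F 0 (Fin.cons x y)) ^ 2 ∂μ + (G y - m) ^ 2)
              ∂(Measure.pi fun _ => μ) := by
          refine integral_mono ?_ ((iF 0).add iG) e1
          exact bdd_integrable (margm (h := fun x => (f x - m) ^ 2) ((hf.sub_const m).pow_const 2))
            (fun y => int_bdd fun x => sq_bdd (sub_bdd (hb _) le_rfl))
      _ = ∫ x, (f x - F 0 x) ^ 2 ∂(Measure.pi fun _ => μ)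
            + ∫ y, (G y - m) ^ 2 ∂(Measure.pi fun _ => μ) := by
          rw [integral_add (iF 0) iG, integral_cons μ n (mF 0) (bF 0)]
      _ ≤ _ := by
          rw [Fin.sum_univ_succ]
          refine add_le_add le_rfl ?_
          rw [hmG]
          refine (ih G (fun j y => ∫ x, F j.succ (Fin.cons x y) ∂μ) hGm hGb
            (fun j => margm (hF _)) (fun j y => int_bdd fun x => hFb _ _) ?_).trans ?_
          · intro j x y
            congr 1
            ext t
            rw [Fin.cons_update, hFu]
          · refine Finset.sum_le_sum fun j _ => ?_
            rw [integral_cons μ n (mF j.succ) (bF j.succ)]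
            refine integral_mono ?_ (iF j.succ) ?_
            · exact bdd_integrable ((hGm.sub (margm (hF _))).pow_const 2)
                (fun y => sq_bdd (sub_bdd (hGb y) (int_bdd fun x => hFb _ _)))
            · intro y
              simp only [hG]
              rw [← integral_sub (bdd_integrable (fibm hf y) fun x => hb _)
                (bdd_integrable (fibm (hF _) y) fun x => hFb _ _)]
              exact jensen_sq ((fibm hf y).sub (fibm (hF _) y))
                (fun x => sub_bdd (hb _) (hFb _ _))

/-- Resampling one coordinate preserves the product law. -/
theorem mp_update {α : Type*} [MeasurableSpace α] (μ : Measure α) [IsProbabilityMeasure μ]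
    {n : ℕ} (j : Fin n) :
    MeasurePreserving (fun z : (Fin n → α) × α => Function.update z.1 j z.2)
      ((Measure.pi fun _ => μ).prod μ) (Measure.pi fun _ => μ) := by
  have hm : Measurable (fun z : (Fin n → α) × α => Function.update z.1 j z.2) := by
    rw [measurable_pi_iff]
    intro i
    by_cases h : i = j
    · subst h; simpa using measurable_snd
    · simp only [Function.update_of_ne h]; fun_prop
  refine ⟨hm, ?_⟩
  symm
  refine Measure.pi_eq fun s hs => ?_
  rw [Measure.map_apply hm (MeasurableSet.univ_pi hs)]
  have : (fun z : (Fin n → α) × α => Function.update z.1 j z.2) ⁻¹' (Set.univ.pi s)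
      = (Set.univ.pi (Function.update s j Set.univ)) ×ˢ (s j) := by
    ext z
    simp only [Set.mem_preimage, Set.mem_pi, Set.mem_univ, true_imp_iff, Set.mem_prod]
    constructor
    · intro h
      refine ⟨fun i => ?_, by simpa using h j⟩
      by_cases hi : i = j
      · subst hi; simp
      · simpa [Function.update_of_ne hi] using h i
    · rintro ⟨h1, h2⟩ i
      by_cases hi : i = j
      · subst hi; simpa using h2
      · simpa [Function.update_of_ne hi] using h1 i
  rw [this, Measure.prod_prod, Measure.pi_pi, ← Finset.prod_erase_mul (s := Finset.univ) (a := j) (h := Finset.mem_univ j),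
    ← Finset.prod_erase_mul (s := Finset.univ) (a := j) (f := fun i => μ (s i)) (h := Finset.mem_univ j)]
  simp only [Function.update_self, measure_univ, mul_one]
  congr 1
  refine Finset.prod_congr rfl fun i hi => ?_
  rw [Function.update_of_ne (Finset.ne_of_mem_erase hi)]

theorem integral_update {α : Type*} [MeasurableSpace α] (μ : Measure α) [IsProbabilityMeasure μ]
    {n : ℕ} (j : Fin n) {f : (Fin n → α) → ℝ} (hf : Measurable f) {c : ℝ} (hb : ∀ x, |f x| ≤ c) :
    ∫ x, f x ∂(Measure.pi fun _ : Fin n => μ)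
      = ∫ x, ∫ t, f (Function.update x j t) ∂μ ∂(Measure.pi fun _ : Fin n => μ) := by
  have hmp := mp_update μ j
  conv_lhs => rw [← hmp.map_eq]
  rw [integral_map hmp.measurable.aemeasurable hf.aestronglyMeasurable, integral_prod]
  exact bdd_integrable (hf.comp hmp.measurable) (fun x => hb _)

theorem ae_update {α : Type*} [MeasurableSpace α] (μ : Measure α) [IsProbabilityMeasure μ]
    {n : ℕ} (j : Fin n) {S : Set (Fin n → α)} (hS : MeasurableSet S)
    (h : ∀ x, ∀ᵐ t ∂μ, Function.update x j t ∈ S) :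
    ∀ᵐ x ∂(Measure.pi fun _ : Fin n => μ), x ∈ S := by
  have hmp := mp_update μ j
  rw [← hmp.map_eq]
  refine (ae_map_iff (p := fun x => x ∈ S) hmp.measurable.aemeasurable hS).2 ?_
  have h2 : MeasurableSet {z : (Fin n → α) × α | Function.update z.1 j z.2 ∈ S} :=
    hmp.measurable hS
  rw [Measure.ae_prod_iff_ae_ae h2]
  exact Eventually.of_forall h

/-- Permuting coordinates preserves the product law. -/
theorem integral_perm {α : Type*} [MeasurableSpace α] (μ : Measure α) [IsProbabilityMeasure μ]
    {n : ℕ} (e : Equiv.Perm (Fin n)) (f : (Fin n → α) → ℝ) :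
    ∫ x, f (x ∘ e) ∂(Measure.pi fun _ : Fin n => μ) = ∫ x, f x ∂(Measure.pi fun _ : Fin n => μ) := by
  have := measurePreserving_piCongrLeft (fun _ : Fin n => μ) e.symm
  have h2 := this.integral_comp' (g := f)
  rw [← h2]
  refine integral_congr_ae (Eventually.of_forall fun x => ?_)
  simp only
  congr 1
  funext k
  have := Equiv.piCongrLeft_apply_apply (fun _ : Fin n => α) e.symm x (e k)
  rw [Equiv.symm_apply_apply] at this
  exact this.symm

/-- Orthogonal projection on the complement of the rows of `B`. -/
noncomputable def rowCompl {m n : ℕ} (B : Matrix (Fin m) (Fin n) ℝ) : Matrix (Fin n) (Fin n) ℝ :=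
  1 - Bᵀ * (B * Bᵀ)⁻¹ * B

theorem rowCompl_symm {m n : ℕ} (B : Matrix (Fin m) (Fin n) ℝ) : (rowCompl B)ᵀ = rowCompl B := by
  simp [rowCompl, Matrix.transpose_nonsing_inv, Matrix.mul_assoc]

theorem inv_cases {m : ℕ} (G : Matrix (Fin m) (Fin m) ℝ) : G⁻¹ * G * G⁻¹ = G⁻¹ := by
  by_cases h : IsUnit G.det
  · rw [Matrix.nonsing_inv_mul _ h, Matrix.one_mul]
  · rw [Matrix.nonsing_inv_apply_not_isUnit _ h]; simp

theorem row_idem {m n : ℕ} (B : Matrix (Fin m) (Fin n) ℝ) :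
    (Bᵀ * (B * Bᵀ)⁻¹ * B) * (Bᵀ * (B * Bᵀ)⁻¹ * B) = Bᵀ * (B * Bᵀ)⁻¹ * B := by
  calc _ = Bᵀ * ((B * Bᵀ)⁻¹ * (B * Bᵀ) * (B * Bᵀ)⁻¹) * B := by
        simp only [Matrix.mul_assoc]
    _ = _ := by rw [inv_cases]

theorem rowCompl_idem {m n : ℕ} (B : Matrix (Fin m) (Fin n) ℝ) : rowCompl B * rowCompl B = rowCompl B := by
  unfold rowCompl
  rw [Matrix.mul_sub, Matrix.sub_mul, Matrix.sub_mul, row_idem]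
  simp

theorem rowCompl_trace {m n : ℕ} (B : Matrix (Fin m) (Fin n) ℝ) :
    (n : ℝ) - m ≤ (rowCompl B).trace := by
  unfold rowCompl
  rw [Matrix.trace_sub, Matrix.trace_mul_comm, ← Matrix.mul_assoc, Matrix.trace_mul_comm]
  simp only [Matrix.trace_one, Fintype.card_fin]
  have : ((B * Bᵀ)⁻¹ * (B * Bᵀ)).trace ≤ m := by
    by_cases h : IsUnit (B * Bᵀ).det
    · rw [Matrix.nonsing_inv_mul _ h]; simp
    · rw [Matrix.nonsing_inv_apply_not_isUnit _ h]; simp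
  linarith

theorem rowCompl_perm {m n : ℕ} (B : Matrix (Fin m) (Fin n) ℝ) (e : Equiv.Perm (Fin m)) :
    rowCompl (B.submatrix e id) = rowCompl B := by
  unfold rowCompl
  have h1 : (B.submatrix e id) * (B.submatrix e id)ᵀ = (B * Bᵀ).submatrix e e := by
    rw [Matrix.transpose_submatrix]
    exact Matrix.submatrix_mul_equiv B Bᵀ e (Equiv.refl _) e
  rw [h1, Matrix.inv_submatrix_equiv, Matrix.transpose_submatrix, Matrix.submatrix_mul_equiv,
    Matrix.submatrix_mul_equiv]
  simp

theorem gram_ker {m n : ℕ} (B : Matrix (Fin m) (Fin n) ℝ) (c : Fin m → ℝ)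
    (h : (B * Bᵀ) *ᵥ c = 0) : Bᵀ *ᵥ c = 0 := by
  have : (Bᵀ *ᵥ c) ⬝ᵥ (Bᵀ *ᵥ c) = 0 := by
    have h2 : c ⬝ᵥ ((B * Bᵀ) *ᵥ c) = 0 := by rw [h]; simp
    rw [← Matrix.mulVec_mulVec, Matrix.dotProduct_mulVec, ← Matrix.mulVec_transpose] at h2
    exact h2
  exact dotProduct_self_eq_zero.mp this

theorem mul_compl {m n : ℕ} (B : Matrix (Fin m) (Fin n) ℝ) (h : (B * Bᵀ).det ≠ 0) :
    B * rowCompl B = 0 := by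
  unfold rowCompl
  rw [Matrix.mul_sub, ← Matrix.mul_assoc, ← Matrix.mul_assoc,
    Matrix.mul_nonsing_inv _ (isUnit_iff_ne_zero.mpr h)]
  simp

theorem rowCompl_snoc_det {m n : ℕ} (B : Matrix (Fin m) (Fin n) ℝ) (B' : Matrix (Fin (m + 1)) (Fin n) ℝ)
    (hB : ∀ k, B' (Fin.castSucc k) = B k) (h : (B * Bᵀ).det ≠ 0)
    (hx : rowCompl B *ᵥ B' (Fin.last m) ≠ 0) : (B' * B'ᵀ).det ≠ 0 := by
  intro h0
  obtain ⟨c, hc0, hc⟩ := Matrix.exists_mulVec_eq_zero_iff.mpr h0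
  have hk := gram_ker B' c hc
  have hk2 : Bᵀ *ᵥ (fun k => c (Fin.castSucc k)) + c (Fin.last m) • B' (Fin.last m) = 0 := by
    ext l
    have := congrFun hk l
    simp only [Matrix.mulVec, dotProduct, Matrix.transpose_apply, Fin.sum_univ_castSucc, hB,
      Pi.zero_apply] at this
    simp only [Matrix.mulVec, dotProduct, Matrix.transpose_apply, Pi.add_apply, Pi.smul_apply,
      smul_eq_mul, Pi.zero_apply]
    linarith
  have h3 : rowCompl B * Bᵀ = 0 := by
    have := congrArg Matrix.transpose (mul_compl B h)
    rwa [Matrix.transpose_mul, rowCompl_symm, Matrix.transpose_zero] at this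
  have h4 : c (Fin.last m) = 0 := by
    have := congrArg (fun v => rowCompl B *ᵥ v) hk2
    simp only [Matrix.mulVec_add, Matrix.mulVec_mulVec, h3, Matrix.zero_mulVec, zero_add,
      Matrix.mulVec_smul, Matrix.mulVec_zero] at this
    exact (smul_eq_zero.mp this).resolve_right hx
  rw [h4, zero_smul, add_zero] at hk2
  have h5 : (B * Bᵀ) *ᵥ (fun k => c (Fin.castSucc k)) = 0 := by
    rw [← Matrix.mulVec_mulVec, hk2, Matrix.mulVec_zero]
  have h6 : (fun k => c (Fin.castSucc k)) = 0 := by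
    by_contra hne
    exact h (Matrix.exists_mulVec_eq_zero_iff.mp ⟨_, hne, h5⟩)
  apply hc0
  ext k
  refine Fin.lastCases h4 (fun j => ?_) k
  exact congrFun h6 j

theorem rowCompl_snoc {m n : ℕ} (B : Matrix (Fin m) (Fin n) ℝ) (B' : Matrix (Fin (m + 1)) (Fin n) ℝ)
    (hB : ∀ k, B' (Fin.castSucc k) = B k) (h : (B * Bᵀ).det ≠ 0)
    (x : Fin n → ℝ) (hxd : x = rowCompl B *ᵥ B' (Fin.last m))
    (hx : x ≠ 0) : rowCompl B' = rowCompl B - (x ⬝ᵥ x)⁻¹ • Matrix.vecMulVec x x := by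
  have h' := rowCompl_snoc_det B B' hB h (hxd ▸ hx)
  set b := B' (Fin.last m) with hb
  set Q := Bᵀ * (B * Bᵀ)⁻¹ * B with hQ
  set Q' := B'ᵀ * (B' * B'ᵀ)⁻¹ * B' with hQ'
  have cQ : rowCompl B = 1 - Q := rfl
  have cQ' : rowCompl B' = 1 - Q' := rfl
  have Qs : Qᵀ = Q := by
    have := rowCompl_symm B
    rw [cQ, Matrix.transpose_sub, Matrix.transpose_one] at this
    exact sub_right_injective this
  have Qs' : Q'ᵀ = Q' := by
    have := rowCompl_symm B'
    rw [cQ', Matrix.transpose_sub, Matrix.transpose_one] at this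
    exact sub_right_injective this
  have hBQ : B * Q = B := by
    have := mul_compl B h
    rw [cQ, Matrix.mul_sub, Matrix.mul_one, sub_eq_zero] at this
    exact this.symm
  have hBQ' : B' * Q' = B' := by
    have := mul_compl B' h'
    rw [cQ', Matrix.mul_sub, Matrix.mul_one, sub_eq_zero] at this
    exact this.symm
  have rowmul : ∀ {r : ℕ} (D : Matrix (Fin r) (Fin n) ℝ) (S : Matrix (Fin n) (Fin n) ℝ) (k : Fin r),
      (D * S) k = D k ᵥ* S := fun D S k => rfl
  have hb1 : b ᵥ* Q' = b := by rw [hb, ← rowmul, hBQ']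
  have hB1 : B * Q' = B := by
    ext k l
    have : (B * Q') k = B k := by rw [rowmul, ← hB k, ← rowmul, hBQ']
    rw [this]
  have hQQ : Q * Q' = Q := by rw [hQ, Matrix.mul_assoc, hB1]
  have hx1 : x = b - b ᵥ* Q := by
    rw [hxd, cQ, Matrix.sub_mulVec, Matrix.one_mulVec, ← Matrix.vecMul_transpose, Qs]
  have hx2 : x ᵥ* Q' = x := by
    rw [hx1, Matrix.sub_vecMul, Matrix.vecMul_vecMul, hQQ, hb1]
  set R := Q + (x ⬝ᵥ x)⁻¹ • Matrix.vecMulVec x x with hR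
  have hRQ : R * Q' = R := by
    rw [hR, Matrix.add_mul, hQQ, Matrix.smul_mul, Matrix.vecMulVec_mul, hx2]
  have hxx : x ⬝ᵥ x ≠ 0 := fun h0 => hx (dotProduct_self_eq_zero.mp h0)
  have hbx : b ⬝ᵥ x = x ⬝ᵥ x := by
    have e : x = b ᵥ* rowCompl B := by rw [hxd, ← Matrix.vecMul_transpose, rowCompl_symm]
    have e2 : x ᵥ* rowCompl B = x := by
      rw [e, Matrix.vecMul_vecMul, rowCompl_idem]
    calc b ⬝ᵥ x = x ⬝ᵥ b := dotProduct_comm _ _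
      _ = (x ᵥ* rowCompl B) ⬝ᵥ b := by rw [e2]
      _ = x ⬝ᵥ (rowCompl B *ᵥ b) := by rw [Matrix.dotProduct_mulVec]
      _ = _ := by rw [← hxd]
  have hBx : B *ᵥ x = 0 := by rw [hxd, Matrix.mulVec_mulVec, mul_compl B h, Matrix.zero_mulVec]
  have hvR : ∀ v : Fin n → ℝ, v ᵥ* R = v ᵥ* Q + ((x ⬝ᵥ x)⁻¹ * (v ⬝ᵥ x)) • x := by
    intro v
    rw [hR, Matrix.vecMul_add, Matrix.vecMul_smul, Matrix.vecMul_vecMulVec, smul_smul]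
  have hBR : B' * R = B' := by
    ext k l
    have : (B' * R) k = B' k := by
      rw [rowmul, hvR]
      refine Fin.lastCases ?_ (fun j => ?_) k
      · rw [← hb, hbx, inv_mul_cancel₀ hxx, one_smul, hx1]; simp
      · rw [hB, ← rowmul, hBQ]
        have : B j ⬝ᵥ x = 0 := congrFun hBx j
        rw [this]; simp
    rw [this]
  have hQR : Q' * R = Q' := by rw [hQ', Matrix.mul_assoc, hBR]
  have Rs : Rᵀ = R := by
    rw [hR, Matrix.transpose_add, Qs, Matrix.transpose_smul, Matrix.transpose_vecMulVec]
  have : Q' = R := by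
    have := congrArg Matrix.transpose hQR
    rw [Matrix.transpose_mul, Rs, Qs', hRQ] at this
    exact this.symm
  rw [cQ', cQ, this, hR]
  abel

theorem proj_entries {n : ℕ} {P : Matrix (Fin n) (Fin n) ℝ} (hs : Pᵀ = P) (hi : P * P = P)
    (k l : Fin n) : |P k l| ≤ 1 ∧ 0 ≤ P k k := by
  have hs' : ∀ i j, P i j = P j i := fun i j => (congrFun (congrFun hs j) i)
  have e : ∀ k, P k k = ∑ j, P k j ^ 2 := by
    intro k
    conv_lhs => rw [← hi]
    rw [Matrix.mul_apply]
    refine Finset.sum_congr rfl fun j _ => ?_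
    rw [hs' j k]; ring
  have h1 : ∀ j, P k j ^ 2 ≤ P k k := fun j => by
    rw [e k]
    exact Finset.single_le_sum (f := fun j => P k j ^ 2) (fun i _ => sq_nonneg _) (Finset.mem_univ j)
  have h2 : P k k ≤ 1 := by nlinarith [h1 k]
  have h3 : 0 ≤ P k k := by rw [e k]; exact Finset.sum_nonneg fun i _ => sq_nonneg _
  refine ⟨?_, h3⟩
  have := h1 l
  rw [abs_le]; constructor <;> nlinarith

theorem meas_det {Ω : Type*} [MeasurableSpace Ω] {m : ℕ} {M : Ω → Matrix (Fin m) (Fin m) ℝ}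
    (h : ∀ i j, Measurable fun ω => M ω i j) : Measurable fun ω => (M ω).det := by
  simp only [Matrix.det_apply]
  refine Finset.measurable_sum _ fun σ _ => ?_
  refine Measurable.const_smul ?_ _
  exact Finset.measurable_prod _ fun i _ => h _ _

theorem meas_inv {Ω : Type*} [MeasurableSpace Ω] {m : ℕ} {M : Ω → Matrix (Fin m) (Fin m) ℝ}
    (h : ∀ i j, Measurable fun ω => M ω i j) (i j : Fin m) :
    Measurable fun ω => (M ω)⁻¹ i j := by
  simp only [Matrix.inv_def, Ring.inverse_eq_inv', Matrix.smul_apply, smul_eq_mul,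
    Matrix.adjugate_apply]
  refine (meas_det h).inv.mul (meas_det fun a b => ?_)
  by_cases hab : a = j
  · subst hab; simp
  · simpa [Matrix.updateRow_ne hab] using h a b

theorem meas_compl {Ω : Type*} [MeasurableSpace Ω] {m n : ℕ} {B : Ω → Matrix (Fin m) (Fin n) ℝ}
    (h : ∀ i j, Measurable fun ω => B ω i j) (i j : Fin n) :
    Measurable fun ω => rowCompl (B ω) i j := by
  have hg : ∀ i j, Measurable fun ω => (B ω * (B ω)ᵀ) i j := fun i j => by
    simp only [Matrix.mul_apply, Matrix.transpose_apply]
    exact Finset.measurable_sum _ fun k _ => (h _ _).mul (h _ _)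
  simp only [rowCompl, Matrix.sub_apply, Matrix.mul_apply (M := _ * _) (N := B _),
    Matrix.mul_apply (M := (B _)ᵀ) (N := (_)⁻¹),
    Matrix.transpose_apply]
  refine measurable_const.sub (Finset.measurable_sum _ fun k _ => Measurable.mul ?_ (h _ _))
  exact Finset.measurable_sum _ fun l _ => (h _ _).mul (meas_inv hg _ _)

instance instGaussProb (n : ℕ) : IsProbabilityMeasure (gaussianPi n) := by
  unfold gaussianPi; infer_instance

theorem int_zero_of_centered {μ : Measure ℝ} [IsProbabilityMeasure μ] {n : ℕ} (a : Fin n)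
    (f : ℝ → ℝ) (hf0 : ∫ t, f t ∂μ = 0) (H : (Fin n → ℝ) → ℝ)
    (hH : ∀ g t, H (Function.update g a t) = H g) :
    ∫ g, f (g a) * H g ∂(Measure.pi fun _ : Fin n => μ) = 0 := by
  by_cases hi : Integrable (fun g => f (g a) * H g) (Measure.pi fun _ : Fin n => μ)
  · have hmp := mp_update μ a
    have hi' := hi
    rw [← hmp.map_eq] at hi'
    conv_lhs => rw [← hmp.map_eq]
    rw [integral_map hmp.measurable.aemeasurable hi'.aestronglyMeasurable]
    have hc := hi'.comp_aemeasurable hmp.measurable.aemeasurable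
    refine (integral_prod _ hc).trans ?_
    simp only [Function.comp]
    simp only [Function.update_self, hH]
    simp [integral_mul_const, hf0]
  · exact integral_undef hi

/-- fourth Gaussian moment -/
noncomputable def kap : ℝ := ∫ t, t ^ 4 ∂(gaussianReal 0 1)

theorem gint_pow (k : ℕ) : Integrable (fun t : ℝ => t ^ k) (gaussianReal 0 1) := by
  have h := (memLp_id_gaussianReal (μ := 0) (v := 1) k).integrable_norm_pow'
  simp only [id] at h
  refine h.mono' (by fun_prop) (Eventually.of_forall fun t => ?_)
  simp

theorem kap_nonneg : 0 ≤ kap := integral_nonneg fun t => by positivity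

theorem gint1 : ∫ t, t ∂(gaussianReal 0 1) = 0 := integral_id_gaussianReal

theorem gint2 : ∫ t, t ^ 2 ∂(gaussianReal 0 1) = 1 := by
  have h := variance_fun_id_gaussianReal (μ := 0) (v := 1)
  rw [variance_eq_integral (by fun_prop)] at h
  simpa [gint1] using h

theorem gint2' : ∫ t, (t ^ 2 - 1) ∂(gaussianReal 0 1) = 0 := by
  rw [integral_sub (gint_pow 2) (integrable_const _), gint2]; simp

theorem pint_pow {n : ℕ} (j : Fin n) (k : ℕ) :
    Integrable (fun g : Fin n → ℝ => g j ^ k) (gaussianPi n) :=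
  (measurePreserving_eval (fun _ : Fin n => gaussianReal 0 1) j).integrable_comp_of_integrable
    (g := fun t => t ^ k) (gint_pow k)

theorem pint_eval {n : ℕ} (j : Fin n) (k : ℕ) :
    ∫ g, g j ^ k ∂(gaussianPi n) = ∫ t, t ^ k ∂(gaussianReal 0 1) := by
  have := (measurePreserving_eval (fun _ : Fin n => gaussianReal 0 1) j)
  rw [← this.map_eq, integral_map this.measurable.aemeasurable (by fun_prop)]
  rfl

/-- centred products -/
noncomputable def phi {n : ℕ} (q : Fin n × Fin n) (g : Fin n → ℝ) : ℝ :=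
  g q.1 * g q.2 - if q.1 = q.2 then 1 else 0

theorem phi_meas {n : ℕ} (q : Fin n × Fin n) : Measurable (phi q) := by
  unfold phi; fun_prop

theorem phi_sq_le {n : ℕ} (q : Fin n × Fin n) (g : Fin n → ℝ) :
    phi q g ^ 2 ≤ g q.1 ^ 4 + g q.2 ^ 4 + 2 := by
  unfold phi
  split_ifs
  · nlinarith [sq_nonneg (g q.1 ^ 2 - g q.2 ^ 2), sq_nonneg (g q.1 * g q.2 + 1)]
  · nlinarith [sq_nonneg (g q.1 ^ 2 - g q.2 ^ 2), sq_nonneg (g q.1 * g q.2)]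

theorem phi_bd_int {n : ℕ} (q : Fin n × Fin n) :
    Integrable (fun g : Fin n → ℝ => g q.1 ^ 4 + g q.2 ^ 4 + 2) (gaussianPi n) :=
  ((pint_pow _ 4).add (pint_pow _ 4)).add (integrable_const _)

theorem phi_mul_int {n : ℕ} (q r : Fin n × Fin n) :
    Integrable (fun g => phi q g * phi r g) (gaussianPi n) := by
  refine ((phi_bd_int q).add (phi_bd_int r)).mono'
    ((phi_meas q).mul (phi_meas r)).aestronglyMeasurable (Eventually.of_forall fun g => ?_)
  simp only [Pi.add_apply, Real.norm_eq_abs]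
  have h1 := phi_sq_le q g
  have h2 := phi_sq_le r g
  rw [abs_le]
  constructor <;> nlinarith [sq_nonneg (phi q g + phi r g), sq_nonneg (phi q g - phi r g)]

theorem phi_sq_int {n : ℕ} (q : Fin n × Fin n) :
    ∫ g, phi q g * phi q g ∂(gaussianPi n) ≤ 2 * kap + 2 := by
  calc _ ≤ ∫ g : Fin n → ℝ, (g q.1 ^ 4 + g q.2 ^ 4 + 2) ∂(gaussianPi n) :=
        integral_mono (phi_mul_int q q) (phi_bd_int q) fun g => by
          have := phi_sq_le q g
          simp only; nlinarith
    _ = _ := by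
        have h : Integrable (fun g : Fin n → ℝ => g q.1 ^ 4 + g q.2 ^ 4) (gaussianPi n) :=
          (pint_pow _ 4).add (pint_pow _ 4)
        rw [integral_add h (integrable_const _), integral_add (pint_pow _ 4) (pint_pow _ 4),
          pint_eval, pint_eval]
        simp [kap]; ring

theorem phi_single {n : ℕ} (q r : Fin n × Fin n) (h1 : q.1 ≠ q.2) (h2 : q.1 ≠ r.1)
    (h3 : q.1 ≠ r.2) : ∫ g, phi q g * phi r g ∂(gaussianPi n) = 0 := by
  have := int_zero_of_centered (μ := gaussianReal 0 1) q.1 (fun t => t) gint1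
    (fun g => g q.2 * phi r g) (fun g t => by
      simp [phi, Function.update_of_ne h1.symm, Function.update_of_ne h2.symm,
        Function.update_of_ne h3.symm])
  refine Eq.trans ?_ this
  refine integral_congr_ae (Eventually.of_forall fun g => ?_)
  simp [phi, h1]; ring

theorem phi_swap {n : ℕ} (q : Fin n × Fin n) : phi q.swap = phi q := by
  ext g
  simp [phi, eq_comm, mul_comm]

theorem phi_orth_aux {n : ℕ} (q r : Fin n × Fin n) (h1 : r ≠ q) (h2 : r ≠ q.swap)
    (hq : q.1 ≠ q.2) : ∫ g, phi q g * phi r g ∂(gaussianPi n) = 0 := by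
  obtain ⟨j, k⟩ := q
  obtain ⟨l, m⟩ := r
  simp only [ne_eq, Prod.mk.injEq, Prod.swap_prod_mk] at h1 h2 hq
  by_cases hj : j ≠ l ∧ j ≠ m
  · exact phi_single (j, k) (l, m) hq hj.1 hj.2
  by_cases hk : k ≠ l ∧ k ≠ m
  · have := phi_single (k, j) (l, m) (Ne.symm hq) hk.1 hk.2
    rw [← this, ← phi_swap (k, j)]; rfl
  exfalso
  push Not at hj hk
  by_cases hjl : j = l
  · subst hjl
    exact h1 ⟨rfl, (hk (Ne.symm hq)).symm⟩
  · have hjm := hj hjl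
    subst hjm
    by_cases hkl : k = l
    · exact h2 ⟨hkl.symm, rfl⟩
    · exact hq (hk hkl).symm

theorem phi_orth {n : ℕ} (q r : Fin n × Fin n) (h1 : r ≠ q) (h2 : r ≠ q.swap) :
    ∫ g, phi q g * phi r g ∂(gaussianPi n) = 0 := by
  by_cases hq : q.1 ≠ q.2
  · exact phi_orth_aux q r h1 h2 hq
  by_cases hr : r.1 ≠ r.2
  · have := phi_orth_aux r q h1.symm (fun h => h2 (by rw [h, Prod.swap_swap])) hr
    rw [← this]; congr 1; ext g; ring
  obtain ⟨j, k⟩ := q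
  obtain ⟨l, m⟩ := r
  simp only [ne_eq, not_not] at hq hr
  subst hq hr
  have hjl : l ≠ j := fun h => h1 (by rw [h])
  have := int_zero_of_centered (μ := gaussianReal 0 1) j (fun t => t ^ 2 - 1) gint2'
    (phi (l, l)) (fun g t => by simp [phi, Function.update_of_ne hjl])
  refine Eq.trans ?_ this
  refine integral_congr_ae (Eventually.of_forall fun g => ?_)
  simp only [phi, if_true]; ring

theorem quad_var {n : ℕ} (S : Fin n → Fin n → ℝ) (hS : ∀ i j, S i j = S j i) :
    Integrable (fun g => (∑ q : Fin n × Fin n, S q.1 q.2 * phi q g) ^ 2) (gaussianPi n) ∧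
    ∫ g, (∑ q : Fin n × Fin n, S q.1 q.2 * phi q g) ^ 2 ∂(gaussianPi n)
      ≤ 2 * (2 * kap + 2) * ∑ q : Fin n × Fin n, S q.1 q.2 ^ 2 := by
  have e : ∀ g : Fin n → ℝ, (∑ q : Fin n × Fin n, S q.1 q.2 * phi q g) ^ 2
      = ∑ q : Fin n × Fin n, ∑ r : Fin n × Fin n,
          (S q.1 q.2 * S r.1 r.2) * (phi q g * phi r g) := by
    intro g
    rw [sq, Finset.sum_mul_sum]
    refine Finset.sum_congr rfl fun q _ => Finset.sum_congr rfl fun r _ => by ring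
  simp_rw [e]
  have i1 : ∀ q r : Fin n × Fin n, Integrable
      (fun g => (S q.1 q.2 * S r.1 r.2) * (phi q g * phi r g)) (gaussianPi n) :=
    fun q r => (phi_mul_int q r).const_mul _
  have i2 : ∀ q : Fin n × Fin n, Integrable
      (fun g => ∑ r : Fin n × Fin n, (S q.1 q.2 * S r.1 r.2) * (phi q g * phi r g))
      (gaussianPi n) := fun q => integrable_finsetSum _ fun r _ => i1 q r
  refine ⟨integrable_finsetSum _ fun q _ => i2 q, ?_⟩
  rw [integral_finsetSum _ fun q _ => i2 q, Finset.mul_sum]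
  refine Finset.sum_le_sum fun q _ => ?_
  rw [integral_finsetSum _ fun r _ => i1 q r]
  set K := 2 * kap + 2 with hK
  have hK0 : 0 ≤ K := by have := kap_nonneg; positivity
  have hb : ∀ r : Fin n × Fin n,
      ∫ g, (S q.1 q.2 * S r.1 r.2) * (phi q g * phi r g) ∂(gaussianPi n)
      ≤ (if r = q then K * S q.1 q.2 ^ 2 else 0) + (if r = q.swap then K * S q.1 q.2 ^ 2 else 0) := by
    intro r
    rw [integral_const_mul]
    have hnn : 0 ≤ K * S q.1 q.2 ^ 2 := by positivity
    have hq := phi_sq_int q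
    rw [← hK] at hq
    by_cases h1 : r = q
    · subst h1
      rw [if_pos rfl]
      have : (0:ℝ) ≤ if r = r.swap then K * S r.1 r.2 ^ 2 else 0 := by split_ifs <;> positivity
      nlinarith [mul_le_mul_of_nonneg_left hq (sq_nonneg (S r.1 r.2))]
    · by_cases h2 : r = q.swap
      · rw [if_neg h1, if_pos h2, h2, phi_swap, Prod.fst_swap, Prod.snd_swap, hS q.2 q.1]
        nlinarith [mul_le_mul_of_nonneg_left hq (sq_nonneg (S q.1 q.2))]
      · rw [if_neg h1, if_neg h2, phi_orth q r h1 h2]; simp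
  refine (Finset.sum_le_sum fun r _ => hb r).trans ?_
  rw [Finset.sum_add_distrib]
  simp
  linarith

theorem gint_pair {n : ℕ} (j k : Fin n) :
    Integrable (fun g : Fin n → ℝ => g j * g k) (gaussianPi n) ∧
    ∫ g, g j * g k ∂(gaussianPi n) = if j = k then 1 else 0 := by
  constructor
  · refine ((pint_pow j 2).add (pint_pow k 2)).mono' (by fun_prop)
      (Eventually.of_forall fun g => ?_)
    simp only [Pi.add_apply, Real.norm_eq_abs]
    rw [abs_le]
    constructor <;> nlinarith [sq_nonneg (g j + g k), sq_nonneg (g j - g k)]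
  · split_ifs with h
    · subst h
      simp_rw [← sq]
      rw [pint_eval, gint2]
    · exact int_zero_of_centered (μ := gaussianReal 0 1) j (fun t => t) gint1
        (fun g => g k) (fun g t => by simp [Function.update_of_ne (Ne.symm h)])

theorem lin_sq {n : ℕ} (c : Fin n → ℝ) :
    Integrable (fun g : Fin n → ℝ => (∑ j, c j * g j) ^ 2) (gaussianPi n) ∧
    ∫ g, (∑ j, c j * g j) ^ 2 ∂(gaussianPi n) = ∑ j, c j ^ 2 := by
  have e : ∀ g : Fin n → ℝ, (∑ j, c j * g j) ^ 2
      = ∑ j, ∑ k, (c j * c k) * (g j * g k) := by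
    intro g
    rw [sq, Finset.sum_mul_sum]
    refine Finset.sum_congr rfl fun q _ => Finset.sum_congr rfl fun r _ => by ring
  simp_rw [e]
  have i1 : ∀ j k : Fin n, Integrable
      (fun g : Fin n → ℝ => (c j * c k) * (g j * g k)) (gaussianPi n) :=
    fun q r => (gint_pair q r).1.const_mul _
  have i2 : ∀ j : Fin n, Integrable
      (fun g : Fin n → ℝ => ∑ k, (c j * c k) * (g j * g k))
      (gaussianPi n) := fun q => integrable_finsetSum _ fun r _ => i1 q r
  refine ⟨integrable_finsetSum _ fun q _ => i2 q, ?_⟩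
  rw [integral_finsetSum _ fun q _ => i2 q]
  refine Finset.sum_congr rfl fun j _ => ?_
  rw [integral_finsetSum _ fun r _ => i1 j r]
  simp_rw [integral_const_mul, (gint_pair _ _).2]
  simp [sq]

/-- The normalised quadratic form `(∑ d_k² x_k²)/(∑ x_k²)` at `x = P A g`. -/
noncomputable def hfun {n : ℕ} (P : Matrix (Fin n) (Fin n) ℝ) (a d : Fin n → ℝ) (g : Fin n → ℝ) : ℝ :=
  (∑ k, d k ^ 2 * (∑ j, (P k j * a j) * g j) ^ 2) / (∑ k, (∑ j, (P k j * a j) * g j) ^ 2)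

theorem hfun_nonneg {n : ℕ} (P : Matrix (Fin n) (Fin n) ℝ) (a d : Fin n → ℝ) (g : Fin n → ℝ) :
    0 ≤ hfun P a d g := by
  unfold hfun; positivity

theorem hfun_le {n : ℕ} (P : Matrix (Fin n) (Fin n) ℝ) (a d : Fin n → ℝ) (g : Fin n → ℝ) :
    hfun P a d g ≤ ∑ k, d k ^ 2 := by
  unfold hfun
  refine div_le_of_le_mul₀ (by positivity) (by positivity) ?_
  rw [Finset.mul_sum]
  refine Finset.sum_le_sum fun k _ => ?_
  gcongr
  exact Finset.single_le_sum (f := fun k => d k ^ 2) (fun i _ => sq_nonneg _) (Finset.mem_univ k)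

theorem quad_expand {n : ℕ} (P : Matrix (Fin n) (Fin n) ℝ) (hs : Pᵀ = P) (hi : P * P = P)
    (a g : Fin n → ℝ) :
    ∑ q : Fin n × Fin n, (a q.1 * P q.1 q.2 * a q.2) * phi q g
      = (∑ k, (∑ j, (P k j * a j) * g j) ^ 2) - ∑ j, a j ^ 2 * P j j := by
  have hs' : ∀ i j, P i j = P j i := fun i j => (congrFun (congrFun hs j) i)
  have hi' : ∀ i j, P i j = ∑ k, P k i * P k j := fun i j => by
    conv_lhs => rw [← hi]
    rw [Matrix.mul_apply]
    exact Finset.sum_congr rfl fun k _ => by rw [hs' i k]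
  rw [Fintype.sum_prod_type]
  simp only [phi, mul_sub, Finset.sum_sub_distrib]
  congr 1
  · simp_rw [sq, Finset.sum_mul_sum]
    have hc : ∀ F : Fin n → Fin n → Fin n → ℝ,
        ∑ k, ∑ i, ∑ j, F k i j = ∑ i, ∑ j, ∑ k, F k i j := fun F => by
      rw [Finset.sum_comm]
      exact Finset.sum_congr rfl fun i _ => Finset.sum_comm
    rw [hc]
    refine Finset.sum_congr rfl fun i _ => Finset.sum_congr rfl fun j _ => ?_
    rw [hi' i j, Finset.mul_sum, Finset.sum_mul, Finset.sum_mul]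
    exact Finset.sum_congr rfl fun k _ => by ring
  · refine Finset.sum_congr rfl fun i _ => ?_
    simp; ring

noncomputable def KK (C : ℝ) : ℝ := 2 * C ^ 2 + 4 * C ^ 4 * (2 * (2 * kap + 2))

theorem KK_pos {C : ℝ} (hC : 1 ≤ C) : 0 < KK C := by
  have := kap_nonneg
  unfold KK; positivity

theorem hfun_meas {n : ℕ} (P : Matrix (Fin n) (Fin n) ℝ) (a d : Fin n → ℝ) :
    Measurable (hfun P a d) := by
  unfold hfun; fun_prop

theorem gauss_key {n : ℕ} (P : Matrix (Fin n) (Fin n) ℝ) (hs : Pᵀ = P) (hi : P * P = P)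
    (hm : 0 < P.trace) (a d : Fin n → ℝ) {C : ℝ} (hC : 1 ≤ C)
    (ha : ∀ k, C⁻¹ ≤ a k ^ 2 ∧ a k ^ 2 ≤ C) :
    ∫ g, hfun P a d g ∂(gaussianPi n) ≤ KK C * (∑ k, d k ^ 2) / P.trace := by
  have hC0 : 0 < C := by linarith
  have hs' : ∀ i j, P i j = P j i := fun i j => (congrFun (congrFun hs j) i)
  have hrow : ∀ k, ∑ j, P k j ^ 2 = P k k := by
    intro k
    conv_rhs => rw [← hi]
    rw [Matrix.mul_apply]
    refine Finset.sum_congr rfl fun j _ => ?_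
    rw [hs' j k]; ring
  set m := P.trace with hmd
  have hmd' : m = ∑ k, P k k := rfl
  set δ := ∑ k, d k ^ 2 with hδ
  have hδ0 : 0 ≤ δ := Finset.sum_nonneg fun i _ => sq_nonneg _
  set S : Fin n → Fin n → ℝ := fun i j => a i * P i j * a j with hS
  have hSs : ∀ i j, S i j = S j i := fun i j => by simp only [hS]; rw [hs' i j]; ring
  obtain ⟨iV, bV⟩ := quad_var S hSs
  have hS2 : ∑ q : Fin n × Fin n, S q.1 q.2 ^ 2 ≤ C ^ 2 * m := by
    rw [Fintype.sum_prod_type, hmd', Finset.mul_sum]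
    refine Finset.sum_le_sum fun i _ => ?_
    rw [← hrow i, Finset.mul_sum]
    refine Finset.sum_le_sum fun j _ => ?_
    simp only [hS]
    have : a i ^ 2 * a j ^ 2 ≤ C * C :=
      mul_le_mul (ha i).2 (ha j).2 (sq_nonneg _) hC0.le
    nlinarith [mul_le_mul_of_nonneg_right this (sq_nonneg (P i j))]
  have htr : m / C ≤ ∑ j, a j ^ 2 * P j j := by
    rw [hmd', Finset.sum_div]
    refine Finset.sum_le_sum fun j _ => ?_
    rw [div_eq_inv_mul]
    exact mul_le_mul_of_nonneg_right (ha j).1 (proj_entries hs hi j j).2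

  have iN : Integrable (fun g : Fin n → ℝ => ∑ k, d k ^ 2 * (∑ j, (P k j * a j) * g j) ^ 2)
      (gaussianPi n) := integrable_finsetSum _ fun k _ => (lin_sq _).1.const_mul _
  have bN : ∫ g : Fin n → ℝ, (∑ k, d k ^ 2 * (∑ j, (P k j * a j) * g j) ^ 2) ∂(gaussianPi n)
      ≤ C * δ := by
    rw [integral_finsetSum _ fun k _ => (lin_sq _).1.const_mul _, hδ, Finset.mul_sum]
    refine Finset.sum_le_sum fun k _ => ?_
    rw [integral_const_mul, (lin_sq _).2, mul_comm]
    refine mul_le_mul_of_nonneg_right ?_ (sq_nonneg _)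
    have h1 : P k k ≤ 1 := (le_abs_self _).trans (proj_entries hs hi k k).1
    calc ∑ j, (P k j * a j) ^ 2 ≤ ∑ j, C * P k j ^ 2 := Finset.sum_le_sum fun j _ => by
          nlinarith [mul_le_mul_of_nonneg_right (ha j).2 (sq_nonneg (P k j))]
      _ = C * P k k := by rw [← Finset.mul_sum, hrow]
      _ ≤ C := by nlinarith
  have hpt : ∀ g : Fin n → ℝ, hfun P a d g ≤
      (2 * C / m) * (∑ k, d k ^ 2 * (∑ j, (P k j * a j) * g j) ^ 2)
      + (δ * (4 * C ^ 2 / m ^ 2)) * (∑ q : Fin n × Fin n, S q.1 q.2 * phi q g) ^ 2 := by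
    intro g
    rw [quad_expand P hs hi a g]
    set q := ∑ k, (∑ j, (P k j * a j) * g j) ^ 2 with hq
    set N := ∑ k, d k ^ 2 * (∑ j, (P k j * a j) * g j) ^ 2 with hN
    have hN0 : 0 ≤ N := by positivity
    by_cases hc : m / (2 * C) ≤ q
    · have h1 : hfun P a d g ≤ (2 * C / m) * N := by
        change N / q ≤ _
        have hp : 0 < m / (2 * C) := by positivity
        calc N / q ≤ N / (m / (2 * C)) := by gcongr
          _ = _ := by field_simp
      have h2 : 0 ≤ (δ * (4 * C ^ 2 / m ^ 2)) * (q - ∑ j, a j ^ 2 * P j j) ^ 2 := by positivity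
      linarith
    · push Not at hc
      have h1 := hfun_le P a d g
      have h3 : m / (2 * C) ≤ (∑ j, a j ^ 2 * P j j) - q := by
        have : m / C = m / (2 * C) + m / (2 * C) := by field_simp; ring
        linarith
      have h4 : (m / (2 * C)) ^ 2 ≤ (q - ∑ j, a j ^ 2 * P j j) ^ 2 := by
        rw [← neg_sub, neg_sq]
        have : 0 ≤ m / (2 * C) := by positivity
        gcongr
      have h5 : 1 ≤ (4 * C ^ 2 / m ^ 2) * (q - ∑ j, a j ^ 2 * P j j) ^ 2 := by
        calc (1:ℝ) = (4 * C ^ 2 / m ^ 2) * (m / (2 * C)) ^ 2 := by field_simp; ring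
          _ ≤ _ := by gcongr
      have h6 : 0 ≤ (2 * C / m) * N := by positivity
      have h7 := mul_le_mul_of_nonneg_left h5 hδ0
      rw [mul_one] at h7
      rw [mul_assoc]
      linarith
  calc ∫ g, hfun P a d g ∂(gaussianPi n)
      ≤ ∫ g, ((2 * C / m) * (∑ k, d k ^ 2 * (∑ j, (P k j * a j) * g j) ^ 2)
      + (δ * (4 * C ^ 2 / m ^ 2)) * (∑ q : Fin n × Fin n, S q.1 q.2 * phi q g) ^ 2)
        ∂(gaussianPi n) :=
        integral_mono (bdd_integrable (hfun_meas P a d) (c := δ) fun g => by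
          rw [abs_of_nonneg (hfun_nonneg _ _ _ _)]; exact hfun_le _ _ _ _)
          ((iN.const_mul _).add (iV.const_mul _)) hpt
    _ ≤ (2 * C / m) * (C * δ)
        + (δ * (4 * C ^ 2 / m ^ 2)) * (2 * (2 * kap + 2) * (C ^ 2 * m)) := by
        rw [integral_add (iN.const_mul _) (iV.const_mul _), integral_const_mul,
          integral_const_mul]
        have hk := kap_nonneg
        gcongr
        refine bV.trans ?_
        gcongr
    _ = _ := by
        unfold KK
        field_simp

theorem meas_normalize (n : ℕ) : Measurable fun x : Fin n → ℝ => (euclidNorm x)⁻¹ • x := by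
  unfold euclidNorm
  fun_prop

instance instSphereProb (n : ℕ) : IsProbabilityMeasure (uniformSphere n) :=
  Measure.isProbabilityMeasure_map (meas_normalize n).aemeasurable

instance instLawProb (n p : ℕ) : IsProbabilityMeasure (sphereLaw n p) := by
  unfold sphereLaw; infer_instance

theorem norm_cases {n : ℕ} (g : Fin n → ℝ) : euclidNorm g ≠ 0 ∨ g = 0 := by
  by_cases h : euclidNorm g = 0
  · right
    unfold euclidNorm at h
    rw [Real.sqrt_eq_zero (Finset.sum_nonneg fun i _ => sq_nonneg _),
      Finset.sum_eq_zero_iff_of_nonneg (fun i _ => sq_nonneg _)] at h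
    ext i
    exact pow_eq_zero_iff (two_ne_zero) |>.mp (h i (Finset.mem_univ i))
  · left; exact h

theorem hfun_smul {n : ℕ} (P : Matrix (Fin n) (Fin n) ℝ) (a d g : Fin n → ℝ) {c : ℝ} (hc : c ≠ 0) :
    hfun P a d (c • g) = hfun P a d g := by
  unfold hfun
  have h : ∀ k, (∑ j, (P k j * a j) * (c • g) j) ^ 2 = c ^ 2 * (∑ j, (P k j * a j) * g j) ^ 2 := by
    intro k
    rw [← mul_pow, Finset.mul_sum]
    congr 1
    exact Finset.sum_congr rfl fun j _ => by simp only [Pi.smul_apply, smul_eq_mul]; ring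
  simp_rw [h]
  rw [← Finset.mul_sum]
  have h2 : ∑ k, d k ^ 2 * (c ^ 2 * (∑ j, (P k j * a j) * g j) ^ 2)
      = c ^ 2 * ∑ k, d k ^ 2 * (∑ j, (P k j * a j) * g j) ^ 2 := by
    rw [Finset.mul_sum]
    exact Finset.sum_congr rfl fun j _ => by ring
  rw [h2]
  exact mul_div_mul_left _ _ (pow_ne_zero 2 hc)

theorem sphere_key {n : ℕ} (P : Matrix (Fin n) (Fin n) ℝ) (hs : Pᵀ = P) (hi : P * P = P)
    (hm : 0 < P.trace) (a d : Fin n → ℝ) {C : ℝ} (hC : 1 ≤ C)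
    (ha : ∀ k, C⁻¹ ≤ a k ^ 2 ∧ a k ^ 2 ≤ C) :
    ∫ u, hfun P a d u ∂(uniformSphere n) ≤ KK C * (∑ k, d k ^ 2) / P.trace := by
  refine le_trans (le_of_eq ?_) (gauss_key P hs hi hm a d hC ha)
  unfold uniformSphere
  rw [integral_map (meas_normalize n).aemeasurable (hfun_meas P a d).aestronglyMeasurable]
  congr 1
  ext g
  rcases norm_cases g with h | h
  · exact hfun_smul P a d g (inv_ne_zero h)
  · subst h; simp

theorem sphere_null {n : ℕ} (P : Matrix (Fin n) (Fin n) ℝ)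
    (hm : 0 < P.trace) (a : Fin n → ℝ) (ha : ∀ k, a k ≠ 0) :
    ∀ᵐ u ∂(uniformSphere n), P *ᵥ (Matrix.diagonal a *ᵥ u) ≠ 0 := by
  have hk : ∃ k, P k k ≠ 0 := by
    by_contra hcon
    push Not at hcon
    simp [Matrix.trace, hcon] at hm
  obtain ⟨k, hk⟩ := hk
  have hform : ∀ u : Fin n → ℝ, P *ᵥ (Matrix.diagonal a *ᵥ u) = fun i => ∑ j, P i j * (a j * u j) := by
    intro u; ext i
    simp [Matrix.mulVec_diagonal, Matrix.mulVec, dotProduct, Matrix.diagonal_apply]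
  have hms : MeasurableSet {u : Fin n → ℝ | ∑ j, P k j * (a j * u j) ≠ 0} := by
    have : Measurable fun u : Fin n → ℝ => ∑ j, P k j * (a j * u j) := by fun_prop
    exact (this (measurableSet_singleton 0)).compl
  have hg : ∀ᵐ u ∂(gaussianPi n), u ∈ {u : Fin n → ℝ | ∑ j, P k j * (a j * u j) ≠ 0} := by
    refine ae_update (gaussianReal 0 1) k hms fun x => ?_
    have hnull : gaussianReal 0 1
        {-(∑ j ∈ Finset.univ.erase k, P k j * (a j * x j)) / (P k k * a k)} = 0 := by
      have := nullSingletonClass_gaussianReal (μ := 0) (v := 1) one_ne_zero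
      exact measure_singleton _
    have : ∀ᵐ t ∂(gaussianReal 0 1),
        t ≠ -(∑ j ∈ Finset.univ.erase k, P k j * (a j * x j)) / (P k k * a k) :=
      measure_eq_zero_iff_ae_notMem.mp hnull
    filter_upwards [this] with t ht
    change ∑ j, P k j * (a j * Function.update x k t j) ≠ 0
    intro h0
    apply ht
    rw [← Finset.sum_erase_add _ _ (Finset.mem_univ k), Function.update_self] at h0
    have h1 : ∑ j ∈ Finset.univ.erase k, P k j * (a j * Function.update x k t j)
        = ∑ j ∈ Finset.univ.erase k, P k j * (a j * x j) :=
      Finset.sum_congr rfl fun j hj => by rw [Function.update_of_ne (Finset.ne_of_mem_erase hj)]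
    rw [h1] at h0
    rw [eq_div_iff (mul_ne_zero hk (ha k))]
    linarith
  have hu : ∀ᵐ u ∂(uniformSphere n), u ∈ {u : Fin n → ℝ | ∑ j, P k j * (a j * u j) ≠ 0} := by
    unfold uniformSphere
    refine (ae_map_iff (p := fun u => u ∈ {u : Fin n → ℝ | ∑ j, P k j * (a j * u j) ≠ 0})
      (meas_normalize n).aemeasurable hms).2 ?_
    filter_upwards [hg] with g hg0
    have hg0 : ∑ j, P k j * (a j * g j) ≠ 0 := hg0
    change ∑ j, P k j * (a j * ((euclidNorm g)⁻¹ • g) j) ≠ 0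
    rcases norm_cases g with h | h
    · have : ∑ j, P k j * (a j * ((euclidNorm g)⁻¹ • g) j)
          = (euclidNorm g)⁻¹ * ∑ j, P k j * (a j * g j) := by
        rw [Finset.mul_sum]
        exact Finset.sum_congr rfl fun j _ => by simp only [Pi.smul_apply, smul_eq_mul]; ring
      rw [this]
      exact mul_ne_zero (inv_ne_zero h) hg0
    · subst h; simp at hg0
  filter_upwards [hu] with u h0 h1
  rw [hform] at h1
  exact h0 (congrFun h1 k)

theorem projMat_eq {n p : ℕ} (A : Matrix (Fin n) (Fin n) ℝ) (ω : Fin p → Fin n → ℝ) (i : ℕ) :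
    projMat A ω i = rowCompl (rowMat A ω i) := rfl

theorem meas_uVec {n p : ℕ} (i : ℕ) (j : Fin n) :
    Measurable fun ω : Fin p → Fin n → ℝ => uVec ω i j := by
  unfold uVec
  split_ifs with h
  · fun_prop
  · simp

theorem meas_rowMat {n p : ℕ} (A : Matrix (Fin n) (Fin n) ℝ) (i : ℕ) (k : Fin i) (j : Fin n) :
    Measurable fun ω : Fin p → Fin n → ℝ => rowMat A ω i k j := by
  simp only [rowMat, Matrix.of_apply, Matrix.mulVec, dotProduct]
  exact Finset.measurable_sum _ fun l _ => (meas_uVec _ _).const_mul _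

theorem meas_projMat {n p : ℕ} (A : Matrix (Fin n) (Fin n) ℝ) (i : ℕ) (k l : Fin n) :
    Measurable fun ω : Fin p → Fin n → ℝ => projMat A ω i k l :=
  meas_compl (meas_rowMat A i) k l

theorem rowMat_update {n p : ℕ} (A : Matrix (Fin n) (Fin n) ℝ) (ω : Fin p → Fin n → ℝ) (i : ℕ)
    (j : Fin p) (hj : i ≤ j) (u : Fin n → ℝ) :
    rowMat A (Function.update ω j u) i = rowMat A ω i := by
  unfold rowMat uVec
  congr 1
  ext k l
  have hk : (k : ℕ) < p := by omega
  simp only [hk, dite_true]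
  rw [Function.update_of_ne]
  intro h
  have := congrArg Fin.val h
  simp at this
  omega

theorem projMat_update {n p : ℕ} (A : Matrix (Fin n) (Fin n) ℝ) (ω : Fin p → Fin n → ℝ) (i : ℕ)
    (j : Fin p) (hj : i ≤ j) (u : Fin n → ℝ) :
    projMat A (Function.update ω j u) i = projMat A ω i := by
  rw [projMat_eq, projMat_eq, rowMat_update A ω i j hj]

theorem projMat_swap {n p : ℕ} (A : Matrix (Fin n) (Fin n) ℝ) (ω : Fin p → Fin n → ℝ) (i : ℕ)
    (j l : Fin p) (hj : (j : ℕ) < i) (hl : (l : ℕ) < i) (hip : i ≤ p) :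
    projMat A (ω ∘ Equiv.swap j l) i = projMat A ω i := by
  rw [projMat_eq, projMat_eq]
  have : rowMat A (ω ∘ Equiv.swap j l) i
      = (rowMat A ω i).submatrix (Equiv.swap (⟨j, hj⟩ : Fin i) ⟨l, hl⟩) id := by
    ext k m
    simp only [rowMat, Matrix.of_apply, Matrix.submatrix_apply, id]
    have hk : (k : ℕ) < p := by omega
    suffices h : uVec (ω ∘ Equiv.swap j l) (k : ℕ)
        = uVec ω ((Equiv.swap (⟨j, hj⟩ : Fin i) ⟨l, hl⟩ k : Fin i) : ℕ) by rw [h]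
    unfold uVec
    have hk2 : ((Equiv.swap (⟨j, hj⟩ : Fin i) ⟨l, hl⟩ k : Fin i) : ℕ) < p := by omega
    simp only [hk, hk2, dite_true, Function.comp]
    congr 1
    simp only [Equiv.swap_apply_def, Fin.ext_iff]
    split_ifs <;> rfl
  rw [this, rowCompl_perm]

theorem trace_pos_proj {n p : ℕ} (A : Matrix (Fin n) (Fin n) ℝ) (ω : Fin p → Fin n → ℝ) (i : ℕ)
    (hi : i < n) : 0 < (projMat A ω i).trace := by
  have := rowCompl_trace (rowMat A ω i)
  have h2 : (i : ℝ) < n := by exact_mod_cast hi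
  rw [projMat_eq]; linarith

theorem ae_x_ne {n p : ℕ} (a : Fin n → ℝ) (ha : ∀ k, a k ≠ 0) (i : ℕ) (hi : i < p) (hpn : p ≤ n) :
    ∀ᵐ ω ∂(sphereLaw n p),
      projMat (Matrix.diagonal a) ω i *ᵥ (Matrix.diagonal a *ᵥ ω ⟨i, hi⟩) ≠ 0 := by
  have hms : MeasurableSet {ω : Fin p → Fin n → ℝ |
      projMat (Matrix.diagonal a) ω i *ᵥ (Matrix.diagonal a *ᵥ ω ⟨i, hi⟩) ≠ 0} := by
    have : Measurable fun ω : Fin p → Fin n → ℝ =>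
        projMat (Matrix.diagonal a) ω i *ᵥ (Matrix.diagonal a *ᵥ ω ⟨i, hi⟩) := by
      rw [measurable_pi_iff]
      intro k
      simp only [Matrix.mulVec, dotProduct]
      refine Finset.measurable_sum _ fun l _ => (meas_projMat _ _ _ _).mul ?_
      fun_prop
    exact (this (measurableSet_singleton 0)).compl
  refine ae_update (uniformSphere n) ⟨i, hi⟩ hms fun ω => ?_
  have := sphere_null (projMat (Matrix.diagonal a) ω i) (trace_pos_proj _ _ _ (by omega)) a ha
  filter_upwards [this] with u hu
  change projMat (Matrix.diagonal a) (Function.update ω ⟨i, hi⟩ u) i *ᵥ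
    (Matrix.diagonal a *ᵥ (Function.update ω ⟨i, hi⟩ u) ⟨i, hi⟩) ≠ 0
  rw [Function.update_self, projMat_update (Matrix.diagonal a) ω i ⟨i, hi⟩ (le_refl _)]
  exact hu

theorem rowMat_castSucc {n p : ℕ} (A : Matrix (Fin n) (Fin n) ℝ) (ω : Fin p → Fin n → ℝ) (i : ℕ)
    (k : Fin i) : rowMat A ω (i + 1) (Fin.castSucc k) = rowMat A ω i k := rfl

theorem rowMat_last {n p : ℕ} (A : Matrix (Fin n) (Fin n) ℝ) (ω : Fin p → Fin n → ℝ) (i : ℕ)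
    (hi : i < p) : rowMat A ω (i + 1) (Fin.last i) = A *ᵥ ω ⟨i, hi⟩ := by
  ext l
  simp [rowMat, uVec, hi]

theorem ae_det {n p : ℕ} (a : Fin n → ℝ) (ha : ∀ k, a k ≠ 0) (hpn : p ≤ n) (i : ℕ) :
    i ≤ p → ∀ᵐ ω ∂(sphereLaw n p),
      (rowMat (Matrix.diagonal a) ω i * (rowMat (Matrix.diagonal a) ω i)ᵀ).det ≠ 0 := by
  induction i with
  | zero => intro _; exact Eventually.of_forall fun ω => by simp
  | succ i ih =>
    intro hi
    filter_upwards [ih (by omega), ae_x_ne a ha i hi hpn] with ω h1 h2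
    refine rowCompl_snoc_det _ _ (rowMat_castSucc _ ω i) h1 ?_
    rw [rowMat_last _ _ _ hi]
    exact h2

/-- `tr(A P_i A)` for diagonal `A`. -/
noncomputable def fA {n p : ℕ} (a : Fin n → ℝ) (i : ℕ) (ω : Fin p → Fin n → ℝ) : ℝ :=
  ∑ k, a k ^ 2 * projMat (Matrix.diagonal a) ω i k k

theorem step_bound {n p : ℕ} (a : Fin n → ℝ) (ha : ∀ k, a k ≠ 0) (hpn : p ≤ n) (i : ℕ)
    (hi : i < p) : ∀ᵐ ω ∂(sphereLaw n p),
      (fA a (i + 1) ω - (fA a i ω - 1)) ^ 2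
        ≤ hfun (projMat (Matrix.diagonal a) ω i) a (fun k => a k ^ 2 - 1) (ω ⟨i, hi⟩) := by
  filter_upwards [ae_det a ha hpn i hi.le, ae_x_ne a ha i hi hpn] with ω h1 h2
  set x := projMat (Matrix.diagonal a) ω i *ᵥ (Matrix.diagonal a *ᵥ ω ⟨i, hi⟩) with hx
  have hxk : ∀ k, ∑ j, (projMat (Matrix.diagonal a) ω i k j * a j) * ω ⟨i, hi⟩ j = x k := by
    intro k
    simp [hx, Matrix.mulVec, dotProduct, Matrix.diagonal_apply, mul_assoc]
  have hP := rowCompl_snoc _ _ (rowMat_castSucc (Matrix.diagonal a) ω i) h1 x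
    (by rw [rowMat_last _ _ _ hi]; rfl) h2
  rw [← projMat_eq, ← projMat_eq] at hP
  have hs : x ⬝ᵥ x = ∑ k, x k ^ 2 := by simp [dotProduct, sq]
  have hs0 : x ⬝ᵥ x ≠ 0 := fun h0 => h2 (dotProduct_self_eq_zero.mp h0)
  rw [hs] at hs0 hP
  unfold hfun
  simp_rw [hxk]
  set s := ∑ k, x k ^ 2 with hsd
  have hsp : 0 < s := lt_of_le_of_ne (Finset.sum_nonneg fun i _ => sq_nonneg _) (Ne.symm hs0)
  have e1 : fA a (i + 1) ω = fA a i ω - s⁻¹ * ∑ k, a k ^ 2 * x k ^ 2 := by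
    unfold fA
    rw [Finset.mul_sum, ← Finset.sum_sub_distrib]
    refine Finset.sum_congr rfl fun k _ => ?_
    rw [hP]
    simp [Matrix.vecMulVec_apply]; ring
  have e2 : ∑ k, a k ^ 2 * x k ^ 2 = ∑ k, ((a k ^ 2 - 1) * x k) * x k + s := by
    rw [hsd, ← Finset.sum_add_distrib]
    exact Finset.sum_congr rfl fun k _ => by ring
  have e3 : fA a (i + 1) ω - (fA a i ω - 1) = - (s⁻¹ * ∑ k, ((a k ^ 2 - 1) * x k) * x k) := by
    rw [e1, e2, mul_add, inv_mul_cancel₀ hs0]; ring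
  have cs := Finset.sum_mul_sq_le_sq_mul_sq Finset.univ (fun k => (a k ^ 2 - 1) * x k) x
  rw [← hsd] at cs
  simp_rw [mul_pow] at cs
  rw [e3, neg_sq, mul_pow, le_div_iff₀ hsp]
  calc _ ≤ (s⁻¹) ^ 2 * ((∑ k, (a k ^ 2 - 1) ^ 2 * x k ^ 2) * s) * s := by gcongr
    _ = _ := by field_simp

theorem hf_meas {n p : ℕ} (a d : Fin n → ℝ) (i : ℕ) (hi : i < p) :
    Measurable fun ω : Fin p → Fin n → ℝ =>
      hfun (projMat (Matrix.diagonal a) ω i) a d (ω ⟨i, hi⟩) := by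
  unfold hfun
  have h : ∀ k, Measurable fun ω : Fin p → Fin n → ℝ =>
      (∑ j, (projMat (Matrix.diagonal a) ω i k j * a j) * ω ⟨i, hi⟩ j) ^ 2 := fun k =>
    (Finset.measurable_sum _ fun j _ =>
      ((meas_projMat _ _ _ _).mul_const _).mul (by fun_prop)).pow_const 2
  exact (Finset.measurable_sum _ fun k _ => (h k).const_mul _).div
    (Finset.measurable_sum _ fun k _ => h k)

theorem fA_meas {n p : ℕ} (a : Fin n → ℝ) (i : ℕ) :
    Measurable (fA (p := p) a i) := by
  unfold fA
  exact Finset.measurable_sum _ fun k _ => (meas_projMat _ _ _ _).const_mul _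

theorem fA_bdd {n p : ℕ} (a : Fin n → ℝ) (i : ℕ) (ω : Fin p → Fin n → ℝ) :
    |fA a i ω| ≤ ∑ k, a k ^ 2 := by
  unfold fA
  refine (Finset.abs_sum_le_sum_abs _ _).trans (Finset.sum_le_sum fun k _ => ?_)
  rw [abs_mul, abs_of_nonneg (sq_nonneg _)]
  have := (proj_entries (rowCompl_symm (rowMat (Matrix.diagonal a) ω i)) (rowCompl_idem _) k k).1
  rw [← projMat_eq] at this
  nlinarith [sq_nonneg (a k)]

theorem step_int {n p : ℕ} (a : Fin n → ℝ) {C : ℝ} (hC : 1 ≤ C)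
    (ha : ∀ k, C⁻¹ ≤ a k ^ 2 ∧ a k ^ 2 ≤ C) (hpn : p ≤ n) (i : ℕ) (hi : i < p) :
    ∫ ω, (fA a (i + 1) ω - (fA a i ω - 1)) ^ 2 ∂(sphereLaw n p)
      ≤ KK C * (∑ k, (a k ^ 2 - 1) ^ 2) / ((n : ℝ) - i) := by
  have ha0 : ∀ k, a k ≠ 0 := fun k h => by
    have := (ha k).1
    rw [h] at this
    have : 0 < C⁻¹ := by positivity
    norm_num at *; linarith
  have hin : (i : ℝ) < n := by exact_mod_cast (by omega : i < n)
  set d : Fin n → ℝ := fun k => a k ^ 2 - 1 with hd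
  have hfb : ∀ ω : Fin p → Fin n → ℝ,
      |hfun (projMat (Matrix.diagonal a) ω i) a d (ω ⟨i, hi⟩)| ≤ ∑ k, d k ^ 2 := fun ω => by
    rw [abs_of_nonneg (hfun_nonneg _ _ _ _)]; exact hfun_le _ _ _ _
  have hfi : Integrable (fun ω : Fin p → Fin n → ℝ =>
      hfun (projMat (Matrix.diagonal a) ω i) a d (ω ⟨i, hi⟩)) (sphereLaw n p) :=
    bdd_integrable (hf_meas a d i hi) hfb
  have hdm : Measurable fun ω : Fin p → Fin n → ℝ => fA a (i + 1) ω - (fA a i ω - 1) :=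
    (fA_meas a (i + 1)).sub ((fA_meas a i).sub_const 1)
  refine (integral_mono_ae (bdd_integrable (hdm.pow_const 2)
    (fun ω => sq_bdd (sub_bdd (fA_bdd a (i + 1) ω) (sub_bdd (fA_bdd a i ω) le_rfl)))) hfi
    (step_bound a ha0 hpn i hi)).trans ?_
  have := integral_update (uniformSphere n) (⟨i, hi⟩ : Fin p) (hf_meas a d i hi) hfb
  change ∫ ω, hfun (projMat (Matrix.diagonal a) ω i) a d (ω ⟨i, hi⟩) ∂(Measure.pi fun _ => uniformSphere n) ≤ _
  rw [this]
  have hδ : 0 ≤ KK C * ∑ k, d k ^ 2 := mul_nonneg (KK_pos hC).le (by positivity)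
  have hb : ∀ ω : Fin p → Fin n → ℝ, ∫ u, hfun (projMat (Matrix.diagonal a)
      (Function.update ω ⟨i, hi⟩ u) i) a d (Function.update ω ⟨i, hi⟩ u ⟨i, hi⟩) ∂(uniformSphere n)
      ≤ KK C * (∑ k, d k ^ 2) / ((n : ℝ) - i) := by
    intro ω
    simp only [Function.update_self, projMat_update _ ω i ⟨i, hi⟩ le_rfl]
    refine (sphere_key _ (rowCompl_symm _) (rowCompl_idem _)
      (trace_pos_proj (Matrix.diagonal a) ω i (by omega)) a d hC ha).trans ?_
    have h1 := rowCompl_trace (rowMat (Matrix.diagonal a) ω i)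
    rw [← projMat_eq] at h1
    have h2 : 0 < (n : ℝ) - i := by linarith
    exact div_le_div_of_nonneg_left hδ h2 h1
  calc _ ≤ ∫ ω : Fin p → Fin n → ℝ, KK C * (∑ k, d k ^ 2) / ((n : ℝ) - i)
        ∂(Measure.pi fun _ => uniformSphere n) := by
        refine integral_mono_of_nonneg (Eventually.of_forall fun ω => ?_) (integrable_const _)
          (Eventually.of_forall hb)
        exact integral_nonneg fun u => hfun_nonneg _ _ _ _
    _ = _ := by simp [hd]

theorem fA_var {n p : ℕ} (a : Fin n → ℝ) {C : ℝ} (hC : 1 ≤ C)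
    (ha : ∀ k, C⁻¹ ≤ a k ^ 2 ∧ a k ^ 2 ≤ C) (hpn : p ≤ n) (i : ℕ) (hi : i < p) :
    varInt (sphereLaw n p) (fA a (i + 1))
      ≤ p * (KK C * (∑ k, (a k ^ 2 - 1) ^ 2) / ((n : ℝ) - i)) := by
  set q : Fin p := ⟨i, hi⟩ with hq
  set c : ℝ := ∑ k, a k ^ 2 with hc
  have hc0 : 0 ≤ c := Finset.sum_nonneg fun k _ => sq_nonneg _
  set F : Fin p → (Fin p → Fin n → ℝ) → ℝ := fun j ω =>
    if (j : ℕ) ≤ i then fA a i (ω ∘ Equiv.swap j q) - 1 else fA a (i + 1) ω with hF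
  have mperm : ∀ j, Measurable fun ω : Fin p → Fin n → ℝ => ω ∘ Equiv.swap j q := fun j => by
    rw [measurable_pi_iff]; intro k; exact measurable_pi_apply _
  have es := efron_stein (uniformSphere n) (c + 1) p (fA a (i + 1)) F (fA_meas a (i + 1))
    (fun ω => (fA_bdd a (i + 1) ω).trans (by linarith))
    (fun j => by
      simp only [hF]
      split_ifs
      · exact ((fA_meas a i).comp (mperm j)).sub_const 1
      · exact fA_meas a (i + 1))
    (fun j ω => by
      simp only [hF]
      split_ifs
      · exact sub_bdd (fA_bdd a i _) (by simp)
      · exact (fA_bdd a (i + 1) ω).trans (by linarith))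
    (fun j ω u => by
      simp only [hF]
      split_ifs with hji
      · congr 1
        have : Function.update ω j u ∘ Equiv.swap j q
            = Function.update (ω ∘ Equiv.swap j q) q u := by
          ext k l
          by_cases hk : k = q
          · subst hk; simp
          · rw [Function.update_of_ne hk, Function.comp, Function.update_of_ne]
            · rfl
            · intro h
              apply hk
              rw [Equiv.swap_apply_eq_iff, Equiv.swap_apply_left] at h
              exact h
        rw [this]
        unfold fA
        simp only [projMat_update (Matrix.diagonal a) (ω ∘ Equiv.swap j q) i q le_rfl u]
      · unfold fA
        simp only [projMat_update (Matrix.diagonal a) ω (i + 1) j (by omega) u])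
  unfold varInt
  refine es.trans ?_
  have hin : (i : ℝ) < n := by exact_mod_cast (by omega : i < n)
  have h2 : 0 < (n : ℝ) - i := by linarith
  have hnn : 0 ≤ KK C * (∑ k, (a k ^ 2 - 1) ^ 2) / ((n : ℝ) - i) := by
    have := KK_pos hC
    positivity
  have hb : ∀ j : Fin p, ∫ ω, (fA a (i + 1) ω - F j ω) ^ 2 ∂(Measure.pi fun _ => uniformSphere n)
      ≤ KK C * (∑ k, (a k ^ 2 - 1) ^ 2) / ((n : ℝ) - i) := by
    intro j
    by_cases hji : (j : ℕ) ≤ i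
    · refine le_trans (le_of_eq ?_) (step_int a hC ha hpn i hi)
      have := integral_perm (uniformSphere n) (Equiv.swap j q)
        (fun ω => (fA a (i + 1) ω - (fA a i ω - 1)) ^ 2)
      refine Eq.trans ?_ this
      refine integral_congr_ae (Eventually.of_forall fun ω => ?_)
      simp only [hF, if_pos hji]
      have : fA a (i + 1) (ω ∘ Equiv.swap j q) = fA a (i + 1) ω := by
        unfold fA
        rw [projMat_swap _ ω (i + 1) j q (by omega) (by simp [hq]) (by omega)]
      rw [this]
    · simp only [hF, if_neg hji]
      simpa using hnn
  refine (Finset.sum_le_sum fun j _ => hb j).trans ?_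
  simp

theorem entry_bdd {n p : ℕ} (A : Matrix (Fin n) (Fin n) ℝ) (ω : Fin p → Fin n → ℝ) (i : ℕ)
    (k l : Fin n) : |projMat A ω i k l| ≤ 1 :=
  (proj_entries (rowCompl_symm (rowMat A ω i)) (rowCompl_idem _) k l).1

theorem Tstat_eq {n : ℕ} (p : ℕ) (a : Fin n → ℝ) (i : ℕ) :
    Tstat n p (Matrix.diagonal a) i = ∫ ω, fA a i ω ∂(sphereLaw n p) := by
  unfold fA
  rw [integral_finsetSum]
  · unfold Tstat meanProj
    simp only [Matrix.diagonal_mul_diagonal, Matrix.trace, Matrix.diag_apply,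
      Matrix.diagonal_mul, Matrix.of_apply]
    refine Finset.sum_congr rfl fun k _ => ?_
    rw [integral_const_mul, sq]
  · intro k _
    exact (bdd_integrable (meas_projMat _ _ _ _)
      (fun ω => entry_bdd (Matrix.diagonal a) ω i k k)).const_mul _

theorem fA_int {n p : ℕ} (a : Fin n → ℝ) (i : ℕ) : Integrable (fA a i) (sphereLaw n p) :=
  bdd_integrable (fA_meas a i) (fA_bdd a i)

theorem trQ_eq {n p : ℕ} (a : Fin n → ℝ) (i : ℕ) (ω : Fin p → Fin n → ℝ) :
    Matrix.trace (Qmat (Matrix.diagonal a) ω i)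
      = (∫ ω, fA a i ω ∂(sphereLaw n p))⁻¹ * fA a i ω := by
  unfold Qmat
  rw [Matrix.trace_smul, Tstat_eq, smul_eq_mul]
  congr 1
  unfold fA
  simp only [Matrix.trace, Matrix.diag_apply, Matrix.diagonal_mul, Matrix.mul_diagonal]
  exact Finset.sum_congr rfl fun k _ => by ring

theorem mean_lower {n : ℕ} (p : ℕ) (a : Fin n → ℝ) {C : ℝ} (hC : 1 ≤ C)
    (ha : ∀ k, C⁻¹ ≤ a k ^ 2 ∧ a k ^ 2 ≤ C) (i : ℕ) :
    C⁻¹ * ((n : ℝ) - i) ≤ ∫ ω, fA a i ω ∂(sphereLaw n p) := by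
  have hC0 : 0 < C⁻¹ := by positivity
  have h : ∀ ω : Fin p → Fin n → ℝ, C⁻¹ * ((n : ℝ) - i) ≤ fA a i ω := by
    intro ω
    have h1 := rowCompl_trace (rowMat (Matrix.diagonal a) ω i)
    have h2 : C⁻¹ * (projMat (Matrix.diagonal a) ω i).trace ≤ fA a i ω := by
      unfold fA
      rw [Matrix.trace, Finset.mul_sum]
      refine Finset.sum_le_sum fun k _ => ?_
      have := (proj_entries (rowCompl_symm (rowMat (Matrix.diagonal a) ω i))
        (rowCompl_idem _) k k).2
      exact mul_le_mul_of_nonneg_right (ha k).1 this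
    rw [projMat_eq] at h2
    exact (mul_le_mul_of_nonneg_left (by linarith) hC0.le).trans h2
  calc C⁻¹ * ((n : ℝ) - i) = ∫ ω : Fin p → Fin n → ℝ, C⁻¹ * ((n : ℝ) - i) ∂(sphereLaw n p) := by simp
    _ ≤ _ := integral_mono (integrable_const _) (fA_int a i) h

theorem mean_pos {n : ℕ} (p : ℕ) (a : Fin n → ℝ) {C : ℝ} (hC : 1 ≤ C)
    (ha : ∀ k, C⁻¹ ≤ a k ^ 2 ∧ a k ^ 2 ≤ C) (i : ℕ) (hi : i < n) :
    0 < ∫ ω, fA a i ω ∂(sphereLaw n p) := by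
  refine lt_of_lt_of_le ?_ (mean_lower p a hC ha i)
  have : (i : ℝ) < n := by exact_mod_cast hi
  have : 0 < (n : ℝ) - i := by linarith
  positivity

theorem trQ_mean {n : ℕ} (p : ℕ) (a : Fin n → ℝ) {C : ℝ} (hC : 1 ≤ C)
    (ha : ∀ k, C⁻¹ ≤ a k ^ 2 ∧ a k ^ 2 ≤ C) (i : ℕ) (hi : i < n) :
    ∫ ω, Matrix.trace (Qmat (Matrix.diagonal a) ω i) ∂(sphereLaw n p) = 1 := by
  simp_rw [trQ_eq]
  rw [integral_const_mul]
  exact inv_mul_cancel₀ (mean_pos p a hC ha i hi).ne'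

theorem trQ_zero {n p : ℕ} (a : Fin n → ℝ) {C : ℝ} (hC : 1 ≤ C)
    (ha : ∀ k, C⁻¹ ≤ a k ^ 2 ∧ a k ^ 2 ≤ C) (hn : 0 < n) (ω : Fin p → Fin n → ℝ) :
    Matrix.trace (Qmat (Matrix.diagonal a) ω 0) = 1 := by
  have h : ∀ ω : Fin p → Fin n → ℝ, fA a 0 ω = ∑ k, a k ^ 2 := by
    intro ω
    unfold fA projMat
    refine Finset.sum_congr rfl fun k _ => ?_
    simp [Matrix.mul_apply]
  have hp := mean_pos p a hC ha 0 hn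
  rw [trQ_eq]
  simp only [h, integral_const, probReal_univ, one_smul] at hp ⊢
  exact inv_mul_cancel₀ hp.ne'

theorem trQ_meas {n p : ℕ} (a : Fin n → ℝ) (i : ℕ) :
    Measurable fun ω : Fin p → Fin n → ℝ => Matrix.trace (Qmat (Matrix.diagonal a) ω i) := by
  simp_rw [trQ_eq]
  exact (fA_meas a i).const_mul _

theorem trQ_sq_int {n p : ℕ} (a : Fin n → ℝ) (i : ℕ) :
    Integrable (fun ω : Fin p → Fin n → ℝ =>
      (Matrix.trace (Qmat (Matrix.diagonal a) ω i) - 1) ^ 2) (sphereLaw n p) := by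
  refine bdd_integrable (((trQ_meas a i).sub_const 1).pow_const 2)
    (c := (|(∫ ω, fA a i ω ∂(sphereLaw n p))⁻¹| * (∑ k, a k ^ 2) + 1) ^ 2) fun ω => ?_
  refine sq_bdd (sub_bdd ?_ (by simp))
  rw [trQ_eq, abs_mul]
  exact mul_le_mul_of_nonneg_left (fA_bdd a i ω) (abs_nonneg _)

theorem trQ_var {n : ℕ} (p : ℕ) (a : Fin n → ℝ) {C : ℝ} (hC : 1 ≤ C)
    (ha : ∀ k, C⁻¹ ≤ a k ^ 2 ∧ a k ^ 2 ≤ C) (i : ℕ) (hi : i < n) :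
    varInt (sphereLaw n p) (fun ω => Matrix.trace (Qmat (Matrix.diagonal a) ω i))
      = ∫ ω, (Matrix.trace (Qmat (Matrix.diagonal a) ω i) - 1) ^ 2 ∂(sphereLaw n p) := by
  unfold varInt
  simp only
  rw [trQ_mean p a hC ha i hi]

theorem trQ_var' {n : ℕ} (p : ℕ) (a : Fin n → ℝ) (i : ℕ) :
    varInt (sphereLaw n p) (fun ω => Matrix.trace (Qmat (Matrix.diagonal a) ω i))
      = ((∫ ω, fA a i ω ∂(sphereLaw n p))⁻¹) ^ 2 * varInt (sphereLaw n p) (fA a i) := by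
  unfold varInt
  rw [← integral_const_mul]
  simp only [trQ_eq]
  rw [integral_const_mul]
  congr 1
  ext ω
  ring

theorem cheb {α : Type*} [MeasurableSpace α] (μ : Measure α) [IsProbabilityMeasure μ]
    (f : α → ℝ) (hf : Integrable (fun ω => f ω ^ 2) μ) {ε : ℝ} (hε : 0 < ε) :
    μ {ω | ε < |f ω|} ≤ ENNReal.ofReal (ε⁻¹ ^ 2 * ∫ ω, f ω ^ 2 ∂μ) := by
  have h1 := mul_meas_ge_le_integral_of_nonneg (μ := μ) (f := fun ω => f ω ^ 2)
    (Eventually.of_forall fun ω => sq_nonneg _) hf (ε ^ 2)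
  have h2 : μ {ω | ε < |f ω|} ≤ μ {ω | ε ^ 2 ≤ f ω ^ 2} := by
    refine measure_mono fun ω hω => ?_
    have hω : ε < |f ω| := hω
    change ε ^ 2 ≤ f ω ^ 2
    rw [← sq_abs (f ω)]
    gcongr
  refine h2.trans ?_
  rw [← ENNReal.ofReal_toReal (measure_ne_top μ {ω | ε ^ 2 ≤ f ω ^ 2})]
  refine ENNReal.ofReal_le_ofReal ?_
  change ε ^ 2 * (μ {ω | ε ^ 2 ≤ f ω ^ 2}).toReal ≤ _ at h1
  rw [inv_pow, ← div_eq_inv_mul, le_div_iff₀ (by positivity)]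
  linarith

theorem part_c {n : ℕ} (p : ℕ) (a : Fin n → ℝ) {C : ℝ} (hC : 1 ≤ C)
    (ha : ∀ k, C⁻¹ ≤ a k ^ 2 ∧ a k ^ 2 ≤ C) (hpn : p ≤ n) {ε : ℝ} (hε : 0 < ε) :
    sphereLaw n p {ω | ∃ i < p, ε < |Matrix.trace (Qmat (Matrix.diagonal a) ω i) - 1|}
      ≤ ENNReal.ofReal (ε⁻¹ ^ 2 * ∑ i ∈ Finset.Ico 1 p,
          varInt (sphereLaw n p) (fun ω => Matrix.trace (Qmat (Matrix.diagonal a) ω i))) := by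
  have hsub : {ω : Fin p → Fin n → ℝ |
        ∃ i < p, ε < |Matrix.trace (Qmat (Matrix.diagonal a) ω i) - 1|}
      ⊆ ⋃ i ∈ Finset.Ico 1 p, {ω | ε < |Matrix.trace (Qmat (Matrix.diagonal a) ω i) - 1|} := by
    rintro ω ⟨i, hi, h⟩
    have hi0 : i ≠ 0 := by
      rintro rfl
      rw [trQ_zero a hC ha (by omega)] at h
      simp at h
      linarith
    refine Set.mem_biUnion (x := i) ?_ h
    simp; omega
  refine (measure_mono hsub).trans ((measure_biUnion_finset_le _ _).trans ?_)
  rw [Finset.mul_sum, ENNReal.ofReal_sum_of_nonneg]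
  · refine Finset.sum_le_sum fun i hi => ?_
    have hi := Finset.mem_Ico.mp hi
    rw [trQ_var p a hC ha i (by omega)]
    exact cheb _ _ (trQ_sq_int a i) hε
  · intro i _
    unfold varInt
    exact mul_nonneg (by positivity) (integral_nonneg fun ω => sq_nonneg _)

theorem part_a {n : ℕ} (p : ℕ) (a : Fin n → ℝ) {C : ℝ} (hC : 1 ≤ C)
    (ha : ∀ k, C⁻¹ ≤ a k ^ 2 ∧ a k ^ 2 ≤ C) (hpn : p ≤ n) {ε : ℝ} (hε : 0 < ε) :
    sphereLaw n p {ω | ε < |∑ i ∈ Finset.range p,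
        (Matrix.trace (Qmat (Matrix.diagonal a) ω i) - 1)|}
      ≤ ENNReal.ofReal (ε⁻¹ ^ 2 * (n * ∑ i ∈ Finset.Ico 1 p,
          varInt (sphereLaw n p) (fun ω => Matrix.trace (Qmat (Matrix.diagonal a) ω i)))) := by
  have hre : ∀ ω : Fin p → Fin n → ℝ,
      ∑ i ∈ Finset.range p, (Matrix.trace (Qmat (Matrix.diagonal a) ω i) - 1)
        = ∑ i ∈ Finset.Ico 1 p, (Matrix.trace (Qmat (Matrix.diagonal a) ω i) - 1) := by
    intro ω
    symm
    refine Finset.sum_subset (fun i hi => ?_) fun i hi hi2 => ?_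
    · simp at hi ⊢; omega
    · have hi0 : i = 0 := by simp at hi hi2; omega
      have := Finset.mem_range.mp hi
      subst hi0
      rw [trQ_zero a hC ha (by omega), sub_self]
  simp_rw [hre]
  have hle : ∀ ω : Fin p → Fin n → ℝ,
      (∑ i ∈ Finset.Ico 1 p, (Matrix.trace (Qmat (Matrix.diagonal a) ω i) - 1)) ^ 2
      ≤ n * ∑ i ∈ Finset.Ico 1 p, (Matrix.trace (Qmat (Matrix.diagonal a) ω i) - 1) ^ 2 := by
    intro ω
    refine sq_sum_le_card_mul_sum_sq.trans ?_
    refine mul_le_mul_of_nonneg_right ?_ (Finset.sum_nonneg fun i _ => sq_nonneg _)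
    simp only [Nat.card_Ico]
    exact_mod_cast (by omega : p - 1 ≤ n)
  have hR : Integrable (fun ω : Fin p → Fin n → ℝ =>
      (n : ℝ) * ∑ i ∈ Finset.Ico 1 p, (Matrix.trace (Qmat (Matrix.diagonal a) ω i) - 1) ^ 2)
      (sphereLaw n p) :=
    (integrable_finsetSum _ fun i _ => trQ_sq_int a i).const_mul _
  have hm : Measurable fun ω : Fin p → Fin n → ℝ =>
      (∑ i ∈ Finset.Ico 1 p, (Matrix.trace (Qmat (Matrix.diagonal a) ω i) - 1)) ^ 2 :=
    (Finset.measurable_sum _ fun i _ => (trQ_meas a i).sub_const 1).pow_const 2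
  have hL := hR.mono' hm.aestronglyMeasurable (Eventually.of_forall fun ω => by
    rw [Real.norm_eq_abs, abs_of_nonneg (sq_nonneg _)]; exact hle ω)
  refine (cheb _ _ hL hε).trans (ENNReal.ofReal_le_ofReal ?_)
  refine mul_le_mul_of_nonneg_left ?_ (by positivity)
  refine (integral_mono hL hR hle).trans (le_of_eq ?_)
  rw [integral_const_mul, integral_finsetSum _ fun i _ => trQ_sq_int a i]
  congr 1
  refine Finset.sum_congr rfl fun i hi => ?_
  have hi := Finset.mem_Ico.mp hi
  rw [trQ_var p a hC ha i (by omega)]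

theorem sum_var {n : ℕ} (p : ℕ) (a : Fin n → ℝ) {C : ℝ} (hC : 1 ≤ C)
    (ha : ∀ k, C⁻¹ ≤ a k ^ 2 ∧ a k ^ 2 ≤ C) (hpn : p ≤ n) (hn : 0 < n) {θ : ℝ} (hθ : 0 < θ)
    (hnp : θ * n ≤ (n : ℝ) - p) :
    ∑ i ∈ Finset.Ico 1 p,
        varInt (sphereLaw n p) (fun ω => Matrix.trace (Qmat (Matrix.diagonal a) ω i))
      ≤ C ^ 2 * KK C / θ ^ 3 * (∑ k, (a k ^ 2 - 1) ^ 2) / n := by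
  set δ := ∑ k, (a k ^ 2 - 1) ^ 2 with hδ
  have hδ0 : 0 ≤ δ := Finset.sum_nonneg fun k _ => sq_nonneg _
  have hK := KK_pos hC
  have hn' : (0 : ℝ) < n := by exact_mod_cast hn
  have hpn' : (p : ℝ) ≤ n := by exact_mod_cast hpn
  have hC0 : 0 < C := by linarith
  have hb : ∀ i ∈ Finset.Ico 1 p,
      varInt (sphereLaw n p) (fun ω => Matrix.trace (Qmat (Matrix.diagonal a) ω i))
        ≤ C ^ 2 * KK C / θ ^ 3 * δ / n ^ 2 := by
    intro i hi
    obtain ⟨hi1, hi2⟩ := Finset.mem_Ico.mp hi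
    obtain ⟨j, rfl⟩ : ∃ j, i = j + 1 := ⟨i - 1, by omega⟩
    have hv := fA_var a hC ha hpn j (by omega)
    rw [trQ_var']
    have hm := mean_lower p a hC ha (j + 1)
    have hj : ((j + 1 : ℕ) : ℝ) ≤ p := by exact_mod_cast hi2.le
    have hj2 : (j : ℝ) ≤ p := by push_cast at hj; linarith
    have hm2 : C⁻¹ * (θ * n) ≤ ∫ ω, fA a (j + 1) ω ∂(sphereLaw n p) :=
      (mul_le_mul_of_nonneg_left (by linarith) (by positivity)).trans hm
    have hv2 : varInt (sphereLaw n p) (fA a (j + 1)) ≤ n * (KK C * δ / (θ * n)) := by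
      refine hv.trans ?_
      have : KK C * δ / ((n : ℝ) - j) ≤ KK C * δ / (θ * n) :=
        div_le_div_of_nonneg_left (by positivity) (by positivity) (by linarith)
      exact mul_le_mul hpn' this (div_nonneg (by positivity) (by
        have : 0 < θ * n := by positivity
        linarith)) hn'.le
    calc _ ≤ ((C⁻¹ * (θ * n))⁻¹) ^ 2 * (n * (KK C * δ / (θ * n))) := by
          have h0 : (0 : ℝ) < C⁻¹ * (θ * n) := by positivity
          have h1 := inv_anti₀ h0 hm2
          have h2 : 0 ≤ (∫ ω, fA a (j + 1) ω ∂(sphereLaw n p))⁻¹ :=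
            inv_nonneg.mpr (h0.le.trans hm2)
          exact mul_le_mul (pow_le_pow_left₀ h2 h1 2) hv2
            (integral_nonneg fun ω => sq_nonneg _) (by positivity)
      _ = _ := by field_simp
  refine (Finset.sum_le_sum hb).trans ?_
  rw [Finset.sum_const, nsmul_eq_mul]
  have hcard : ((Finset.Ico 1 p).card : ℝ) ≤ n := by
    simp only [Nat.card_Ico]
    exact_mod_cast (by omega : p - 1 ≤ n)
  calc _ ≤ (n : ℝ) * (C ^ 2 * KK C / θ ^ 3 * δ / n ^ 2) :=
        mul_le_mul_of_nonneg_right hcard (by positivity)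
    _ = _ := by field_simp



/-- Under Assumptions (A) and (B), as `n → ∞`:
(a) `∑_{i=0}^{p−1} (tr(Q_i) − 1) → 0` in probability;
(b) `max_{i=0,…,p−1} |tr(Q_i) − 1| → 0` in probability;
(c) for every `ε > 0`, `P(max_i |tr(Q_i) − 1| > ε) ≤ ε⁻² ∑_{i=1}^{p−1} Var(tr(Q_i)) = O(1/n)`. -/
theorem traceQ_concentration (p : ℕ → ℕ) (γ : ℝ)
    (A : ∀ n, Matrix (Fin n) (Fin n) ℝ)
    (hp : ∀ n, p n ≤ n)
    (hdiag : ∀ n, (A n).IsDiag) (hpos : ∀ n k, 0 < A n k k)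
    (htr : ∀ n, Matrix.trace (A n * A n) = (n : ℝ))
    (hγ : 0 < γ ∧ γ < 1)
    (hA : Tendsto (fun n => (p n : ℝ) / (n : ℝ)) atTop (𝓝 γ))
    (C : ℝ) (hC : 1 ≤ C)
    (hCb : ∀ n k, C⁻¹ ≤ (A n k k) ^ 2 ∧ (A n k k) ^ 2 ≤ C)
    (hB2 : Tendsto
      (fun n => Matrix.trace
        ((A n * A n - (Matrix.trace (A n * A n) / (n : ℝ)) • (1 : Matrix (Fin n) (Fin n) ℝ)) ^ 2))
      atTop (𝓝 0)) :
    (∀ ε : ℝ, 0 < ε →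
      Tendsto (fun n => sphereLaw n (p n)
          {ω | ε < |∑ i ∈ Finset.range (p n), (Matrix.trace (Qmat (A n) ω i) - 1)|})
        atTop (𝓝 0)) ∧
    (∀ ε : ℝ, 0 < ε →
      Tendsto (fun n => sphereLaw n (p n)
          {ω | ∃ i < p n, ε < |Matrix.trace (Qmat (A n) ω i) - 1|})
        atTop (𝓝 0)) ∧
    (∀ n : ℕ, ∀ ε : ℝ, 0 < ε →
      sphereLaw n (p n) {ω | ∃ i < p n, ε < |Matrix.trace (Qmat (A n) ω i) - 1|}
        ≤ ENNReal.ofReal (ε⁻¹ ^ 2 *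
            ∑ i ∈ Finset.Ico 1 (p n),
              varInt (sphereLaw n (p n)) (fun ω => Matrix.trace (Qmat (A n) ω i)))) ∧
    (∃ c : ℝ, ∃ N : ℕ, ∀ n ≥ N,
      ∑ i ∈ Finset.Ico 1 (p n),
          varInt (sphereLaw n (p n)) (fun ω => Matrix.trace (Qmat (A n) ω i))
        ≤ c / (n : ℝ)) := by
  obtain ⟨a, rfl⟩ : ∃ a : ∀ n, Fin n → ℝ, A = fun n => Matrix.diagonal (a n) :=
    ⟨fun n => (A n).diag, funext fun n => ((hdiag n).diagonal_diag).symm⟩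
  simp only [Matrix.diagonal_apply_eq] at hCb
  set δ : ℕ → ℝ := fun n => ∑ k, (a n k ^ 2 - 1) ^ 2 with hδ
  have hδ0 : Tendsto δ atTop (𝓝 0) := by
    refine hB2.congr' ?_
    filter_upwards [eventually_gt_atTop 0] with n hn
    have hn' : (n : ℝ) ≠ 0 := by exact_mod_cast hn.ne'
    have h1 := htr n
    simp only at h1 ⊢
    rw [h1, div_self hn', one_smul, Matrix.diagonal_mul_diagonal, ← Matrix.diagonal_one,
      Matrix.diagonal_sub, sq, Matrix.diagonal_mul_diagonal, Matrix.trace_diagonal]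
    exact Finset.sum_congr rfl fun k _ => by ring
  set θ : ℝ := (1 - γ) / 2 with hθd
  have hθ : 0 < θ := by rw [hθd]; linarith [hγ.2]
  have hnp : ∀ᶠ n : ℕ in atTop, 0 < n ∧ θ * n ≤ (n : ℝ) - p n := by
    have h1 : ∀ᶠ n : ℕ in atTop, (p n : ℝ) / n < 1 - θ :=
      hA.eventually (gt_mem_nhds (by rw [hθd]; linarith [hγ.2]))
    filter_upwards [h1, eventually_gt_atTop 0] with n h hn
    have hn' : (0 : ℝ) < n := by exact_mod_cast hn
    refine ⟨hn, ?_⟩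
    rw [div_lt_iff₀ hn'] at h
    linarith
  set K : ℝ := C ^ 2 * KK C / θ ^ 3 with hK
  have hK0 : 0 < K := by
    have := KK_pos hC
    have : 0 < C := by linarith
    positivity
  set V : ℕ → ℝ := fun n => ∑ i ∈ Finset.Ico 1 (p n),
    varInt (sphereLaw n (p n)) (fun ω => Matrix.trace (Qmat (Matrix.diagonal (a n)) ω i)) with hV
  have hVb : ∀ᶠ n : ℕ in atTop, V n ≤ K * δ n / n := by
    filter_upwards [hnp] with n hn
    exact sum_var (p n) (a n) hC (hCb n) (hp n) hn.1 hθ hn.2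
  have hd : ∀ᶠ n : ℕ in atTop, V n ≤ K / n := by
    filter_upwards [hVb, hδ0.eventually (gt_mem_nhds zero_lt_one)] with n h1 h2
    refine h1.trans (div_le_div_of_nonneg_right ?_ (Nat.cast_nonneg n))
    nlinarith
  have hzero : ∀ ε : ℝ, ∀ g : ℕ → ℝ, Tendsto g atTop (𝓝 0) →
      Tendsto (fun n => ENNReal.ofReal (ε⁻¹ ^ 2 * g n)) atTop (𝓝 0) := by
    intro ε g hg
    have := (ENNReal.continuous_ofReal.tendsto _).comp (hg.const_mul (ε⁻¹ ^ 2))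
    simpa [Function.comp_def] using this
  refine ⟨fun ε hε => ?_, fun ε hε => ?_, fun n ε hε => ?_, ?_⟩
  · have hg : Tendsto (fun n => K * δ n) atTop (𝓝 0) := by simpa using hδ0.const_mul K
    refine tendsto_of_tendsto_of_tendsto_of_le_of_le' tendsto_const_nhds (hzero ε _ hg)
      (Eventually.of_forall fun n => zero_le) ?_
    filter_upwards [hVb, hnp] with n h1 h2
    refine (part_a (p n) (a n) hC (hCb n) (hp n) hε).trans (ENNReal.ofReal_le_ofReal ?_)
    refine mul_le_mul_of_nonneg_left ?_ (by positivity)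
    have hn' : (0 : ℝ) < n := by exact_mod_cast h2.1
    rw [le_div_iff₀ hn'] at h1
    change (n : ℝ) * V n ≤ _
    linarith
  · have hg : Tendsto (fun n : ℕ => K / (n : ℝ)) atTop (𝓝 0) :=
      tendsto_const_div_atTop_nhds_zero_nat K
    refine tendsto_of_tendsto_of_tendsto_of_le_of_le' tendsto_const_nhds (hzero ε _ hg)
      (Eventually.of_forall fun n => zero_le) ?_
    filter_upwards [hd] with n h1
    refine (part_c (p n) (a n) hC (hCb n) (hp n) hε).trans (ENNReal.ofReal_le_ofReal ?_)
    exact mul_le_mul_of_nonneg_left h1 (by positivity)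
  · exact part_c (p n) (a n) hC (hCb n) (hp n) hε
  · obtain ⟨N, hN⟩ := eventually_atTop.mp hd
    exact ⟨K, N, hN⟩
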